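/- arXiv:1102.0031 — 3 statements merged into one kernel-verified Lean document; each statement's English description precedes it below -/
import Mathlib

section
/- Let Φ be a root system with exactly N distinct Borel subsets, and let G be a group with a strong Φ-grading {X_α}_{α∈Φ}. Fix f ∈ F(Φ), set G_f = ⟨X_α : α ∈ Φ_f⟩ and CG_f = ⟨X_α : α ∈ C_f⟩; let E_f be the collection of Borel subsets Φ_g with Φ_g ≠ Φ_f and Φ_g ∩ Φ_f ≠ ∅, and for Φ_g ∈ E_f set G_{f,g} = ⟨X_α : α ∈ Φ_f ∩ Φ_g⟩. Put ε_Φ = 8 / ((N − 2)·4^{|Φ|/2}). Then for every unitary representation H of G_f with no nonzero CG_f-invariant vectors and every choice of vectors v_g ∈ H^{G_{f,g}} (Φ_g ∈ E_f), one has ‖Σ_{Φ_g ∈ E_f} v_g‖² ≤ (|E_f|/2)·(1 − ε_Φ)·Σ_{Φ_g ∈ E_f} ‖v_g‖²; in particular, the codistance between the subspaces {H^{G_{f,g}}} is at most (1 − ε_Φ)/2. -/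
section RootSystemDefs

variable {E : Type*} [AddCommGroup E] [Module ℝ E]

/-- A root system in a real vector space `E`: a finite subset that spans `E`,
does not contain `0`, and is closed under negation. -/
structure IsRootSystem (Φ : Set E) : Prop where
  finite : Φ.Finite
  spans : Submodule.span ℝ Φ = ⊤
  zero_notMem : (0 : E) ∉ Φ
  neg_mem : ∀ α ∈ Φ, -α ∈ Φ

/-- `f ∈ F(Φ)`: a linear functional not vanishing on any root and taking
distinct values on distinct roots. -/
def IsRegularFunc (Φ : Set E) (f : E →ₗ[ℝ] ℝ) : Prop :=
  (∀ α ∈ Φ, f α ≠ 0) ∧ ∀ α ∈ Φ, ∀ β ∈ Φ, α ≠ β → f α ≠ f β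

/-- The Borel set `Φ_f = {α ∈ Φ | f α > 0}`. -/
def borelSet (Φ : Set E) (f : E →ₗ[ℝ] ℝ) : Set E :=
  {α ∈ Φ | 0 < f α}

/-- A Borel subset of `Φ`. -/
def IsBorelSet (Φ : Set E) (B : Set E) : Prop :=
  ∃ f : E →ₗ[ℝ] ℝ, IsRegularFunc Φ f ∧ B = borelSet Φ f

/-- Two Borel sets `B₁`, `B₂` are co-maximal if every Borel set containing
`B₁ ∩ B₂` equals `B₁` or `B₂`. -/
def CoMaximal (Φ : Set E) (B₁ B₂ : Set E) : Prop :=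
  ∀ B : Set E, IsBorelSet Φ B → B₁ ∩ B₂ ⊆ B → B = B₁ ∨ B = B₂

/-- The boundary of the Borel set `Φ_f`. -/
def borelBoundary (Φ : Set E) (f : E →ₗ[ℝ] ℝ) : Set E :=
  ⋃ B ∈ {B : Set E | IsBorelSet Φ B ∧ CoMaximal Φ (borelSet Φ f) B}, borelSet Φ f \ B

/-- The core of the Borel set `Φ_f`. -/
def borelCore (Φ : Set E) (f : E →ₗ[ℝ] ℝ) : Set E :=
  borelSet Φ f \ borelBoundary Φ f

/-- `Ψ` is a subsystem of `Φ` if `Ψ = Φ ∩ span ℝ Ψ`. -/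
def IsSubsystem (Φ Ψ : Set E) : Prop :=
  Ψ = Φ ∩ (Submodule.span ℝ Ψ : Set E)

/-- Irreducibility of a root system. -/
def IsIrreducibleRS (Φ : Set E) : Prop :=
  ¬ ∃ Φ₁ Φ₂ : Set E, Φ₁.Nonempty ∧ Φ₂.Nonempty ∧ Φ₁ ∪ Φ₂ = Φ ∧ Disjoint Φ₁ Φ₂ ∧
      Submodule.span ℝ Φ₁ ⊓ Submodule.span ℝ Φ₂ = ⊥

/-- The rank of a subset of `E` (the dimension of its span). -/
noncomputable def rankOf (Ψ : Set E) : ℕ := Module.finrank ℝ (Submodule.span ℝ Ψ)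

/-- Regularity of a root system: every root lies in an irreducible rank-2 subsystem. -/
def IsRegularRS (Φ : Set E) : Prop :=
  ∀ α ∈ Φ, ∃ Ψ : Set E, IsSubsystem Φ Ψ ∧ IsIrreducibleRS Ψ ∧ rankOf Ψ = 2 ∧ α ∈ Ψ

end RootSystemDefs

section GradingDefs

variable {E : Type*} [AddCommGroup E] [Module ℝ E] {G : Type*} [Group G]

/-- The grading condition: for roots `α, β` with `α ∉ ℝ_{<0}·β`, the commutator
`[X_α, X_β]` lies in the subgroup generated by the root subgroups `X_γ` with
`γ = aα + bβ ∈ Φ`, `a, b ≥ 1`. -/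
def GradingCond (Φ : Set E) (X : E → Subgroup G) : Prop :=
  ∀ α ∈ Φ, ∀ β ∈ Φ, (¬ ∃ c : ℝ, c < 0 ∧ α = c • β) →
    ⁅X α, X β⁆ ≤ ⨆ γ ∈ {γ ∈ Φ | ∃ a b : ℝ, 1 ≤ a ∧ 1 ≤ b ∧ γ = a • α + b • β}, X γ

/-- `{X_α}` is a `Φ`-grading of `G`: the grading condition holds and the root
subgroups generate `G`. -/
def IsGrading (Φ : Set E) (X : E → Subgroup G) : Prop :=
  GradingCond Φ X ∧ (⨆ α ∈ Φ, X α) = ⊤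

/-- The grading is strong: for every regular functional `f` and every `γ` in the
core `C_f`, the root subgroup `X_γ` is contained in the subgroup generated by the
`X_β` with `β ∈ Φ_f`, `β ∉ ℝγ`. -/
def IsStrong (Φ : Set E) (X : E → Subgroup G) : Prop :=
  ∀ f : E →ₗ[ℝ] ℝ, IsRegularFunc Φ f → ∀ γ ∈ borelCore Φ f,
    X γ ≤ ⨆ β ∈ {β ∈ borelSet Φ f | ¬ ∃ c : ℝ, β = c • γ}, X β

/-- The grading is `k`-strong: for every irreducible subsystem `Ψ` of rank `k`,
the family `{X_α}_{α ∈ Ψ}` is a strong `Ψ`-grading of the subgroup it generates. -/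
def IsKStrong (Φ : Set E) (X : E → Subgroup G) (k : ℕ) : Prop :=
  ∀ Ψ : Set E, IsSubsystem Φ Ψ → IsIrreducibleRS Ψ → rankOf Ψ = k →
    GradingCond Ψ X ∧ IsStrong Ψ X

end GradingDefs

/-! ### Unitary representations: invariant subspaces -/

section RepPart

open scoped commutatorElement

variable {Γ : Type*} [Group Γ] {H : Type*} [NormedAddCommGroup H] [InnerProductSpace ℂ H]

/-- Vectors fixed by all elements of `A`. -/
def fixSub (ρ : Γ →* (H ≃ₗᵢ[ℂ] H)) (A : Set Γ) : Submodule ℂ H where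
  carrier := {w | ∀ a ∈ A, ρ a w = w}
  add_mem' := by
    intro x y hx hy a ha
    rw [map_add, hx a ha, hy a ha]
  zero_mem' := by
    intro a _
    exact map_zero _
  smul_mem' := by
    intro c x hx a ha
    rw [map_smul, hx a ha]

/-- Invariance of a subspace. -/
def InvSub (ρ : Γ →* (H ≃ₗᵢ[ℂ] H)) (W : Submodule ℂ H) : Prop :=
  ∀ g : Γ, ∀ w ∈ W, ρ g w ∈ W

lemma rho_mul (ρ : Γ →* (H ≃ₗᵢ[ℂ] H)) (g h : Γ) (w : H) : ρ (g * h) w = ρ g (ρ h w) := by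
  rw [map_mul]; rfl

lemma rho_one (ρ : Γ →* (H ≃ₗᵢ[ℂ] H)) (w : H) : ρ 1 w = w := by
  rw [map_one]; rfl

lemma rho_inv_self (ρ : Γ →* (H ≃ₗᵢ[ℂ] H)) (g : Γ) (w : H) : ρ g⁻¹ (ρ g w) = w := by
  rw [← rho_mul, inv_mul_cancel, rho_one]

lemma rho_self_inv (ρ : Γ →* (H ≃ₗᵢ[ℂ] H)) (g : Γ) (w : H) : ρ g (ρ g⁻¹ w) = w := by
  rw [← rho_mul, mul_inv_cancel, rho_one]

lemma rho_inv_of_fix (ρ : Γ →* (H ≃ₗᵢ[ℂ] H)) {g : Γ} {w : H} (h : ρ g w = w) :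
    ρ g⁻¹ w = w := by
  conv_lhs => rw [← h]
  exact rho_inv_self ρ g w

lemma rho_inner (ρ : Γ →* (H ≃ₗᵢ[ℂ] H)) (g : Γ) (u w : H) :
    inner ℂ (ρ g u) (ρ g w) = inner ℂ u w := (ρ g).inner_map_map u w

lemma rho_inner' (ρ : Γ →* (H ≃ₗᵢ[ℂ] H)) (g : Γ) (u w : H) :
    inner ℂ (ρ g u) w = inner ℂ u (ρ g⁻¹ w) := by
  rw [← rho_inner ρ g u, rho_self_inv]

lemma rho_norm (ρ : Γ →* (H ≃ₗᵢ[ℂ] H)) (g : Γ) (u : H) : ‖ρ g u‖ = ‖u‖ := (ρ g).norm_map u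

lemma fixSub_closed (ρ : Γ →* (H ≃ₗᵢ[ℂ] H)) (A : Set Γ) :
    IsClosed (fixSub ρ A : Set H) := by
  have : (fixSub ρ A : Set H) = ⋂ a ∈ A, {w | ρ a w = w} := by
    ext w; simp [fixSub]
  rw [this]
  refine isClosed_biInter fun a _ => isClosed_eq (ρ a).continuous continuous_id

/-- Elements acting trivially on `W`. -/
def fixer (ρ : Γ →* (H ≃ₗᵢ[ℂ] H)) (W : Submodule ℂ H) : Subgroup Γ where
  carrier := {g | ∀ w ∈ W, ρ g w = w}
  mul_mem' := by
    intro a b ha hb w hw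
    rw [rho_mul, hb w hw, ha w hw]
  one_mem' := fun w _ => rho_one ρ w
  inv_mem' := by
    intro a ha w hw
    exact rho_inv_of_fix ρ (ha w hw)

lemma mem_fixer {ρ : Γ →* (H ≃ₗᵢ[ℂ] H)} {W : Submodule ℂ H} {g : Γ} :
    g ∈ fixer ρ W ↔ ∀ w ∈ W, ρ g w = w := Iff.rfl

lemma mem_fixSub {ρ : Γ →* (H ≃ₗᵢ[ℂ] H)} {A : Set Γ} {w : H} :
    w ∈ fixSub ρ A ↔ ∀ a ∈ A, ρ a w = w := Iff.rfl

lemma fixer_normal {ρ : Γ →* (H ≃ₗᵢ[ℂ] H)} {W : Submodule ℂ H} (h : InvSub ρ W) :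
    (fixer ρ W).Normal := by
  constructor
  intro n hn g w hw
  rw [rho_mul, rho_mul, hn _ (h g⁻¹ w hw), rho_self_inv]

lemma fixer_mono {ρ : Γ →* (H ≃ₗᵢ[ℂ] H)} {W W' : Submodule ℂ H} (h : W' ≤ W) :
    fixer ρ W ≤ fixer ρ W' := fun _ hg w hw => hg w (h hw)

lemma comm_of_fixer {ρ : Γ →* (H ≃ₗᵢ[ℂ] H)} {W : Submodule ℂ H} (hW : InvSub ρ W) {a g : Γ}
    (h : ⁅a, g⁆ ∈ fixer ρ W) {w : H} (hw : w ∈ W) : ρ a (ρ g w) = ρ g (ρ a w) := by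
  have := h (ρ g (ρ a w)) (hW _ _ (hW _ _ hw))
  rw [← this, ← rho_mul, ← rho_mul, ← rho_mul]
  congr 2
  rw [commutatorElement_def]; group

lemma InvSub.orth {ρ : Γ →* (H ≃ₗᵢ[ℂ] H)} {W : Submodule ℂ H} (hW : InvSub ρ W) :
    InvSub ρ Wᗮ := by
  intro g w hw
  rw [Submodule.mem_orthogonal'] at hw ⊢
  intro u hu
  rw [rho_inner']
  exact hw _ (hW _ _ hu)

lemma InvSub.inf {ρ : Γ →* (H ≃ₗᵢ[ℂ] H)} {W W' : Submodule ℂ H} (hW : InvSub ρ W)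
    (hW' : InvSub ρ W') : InvSub ρ (W ⊓ W') :=
  fun g w hw => ⟨hW g w hw.1, hW' g w hw.2⟩

lemma hasProj_of_closed [CompleteSpace H] {W : Submodule ℂ H} (h : IsClosed (W : Set H)) :
    W.HasOrthogonalProjection := by
  have : CompleteSpace W := h.completeSpace_coe
  infer_instance

lemma proj_comm {ρ : Γ →* (H ≃ₗᵢ[ℂ] H)} {W : Submodule ℂ H} [W.HasOrthogonalProjection]
    (hW : InvSub ρ W) (g : Γ) (w : H) : ρ g (W.starProjection w) = W.starProjection (ρ g w) := by
  symm
  apply Submodule.eq_starProjection_of_mem_orthogonal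
  · exact hW _ _ (W.starProjection_apply_mem w)
  · rw [← map_sub]
    exact hW.orth _ _ (Submodule.sub_starProjection_mem_orthogonal w)

/-- Splitting off the fixed vectors of `A`. -/
lemma split_fix [CompleteSpace H] {ρ : Γ →* (H ≃ₗᵢ[ℂ] H)} {W : Submodule ℂ H}
    (hWc : IsClosed (W : Set H)) (hW : InvSub ρ W) (A : Set Γ)
    (hA : ∀ a ∈ A, ∀ g : Γ, ⁅a, g⁆ ∈ fixer ρ W)
    (hne : ∃ a ∈ A, a ∉ fixer ρ W) :
    ∃ W' : Submodule ℂ H, W' ≤ W ∧ IsClosed (W' : Set H) ∧ InvSub ρ W' ∧ W' ≠ ⊥ ∧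
      ∀ w ∈ W', (∀ a ∈ A, ρ a w = w) → w = 0 := by
  set F := W ⊓ fixSub ρ A with hF
  have hFc : IsClosed (F : Set H) := hWc.inter (fixSub_closed ρ A)
  have hFi : InvSub ρ F := by
    rintro g w ⟨hw, hwA⟩
    refine ⟨hW g w hw, fun a ha => ?_⟩
    rw [comm_of_fixer hW (hA a ha g) hw, hwA a ha]
  have := hasProj_of_closed hFc
  refine ⟨W ⊓ Fᗮ, inf_le_left, hWc.inter F.isClosed_orthogonal, hW.inf hFi.orth, ?_, ?_⟩
  · intro hbot
    obtain ⟨a, ha, hna⟩ := hne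
    apply hna
    intro w hw
    have h1 : w - F.starProjection w ∈ W ⊓ Fᗮ :=
      ⟨W.sub_mem hw (F.starProjection_apply_mem w).1, Submodule.sub_starProjection_mem_orthogonal w⟩
    rw [hbot, Submodule.mem_bot, sub_eq_zero] at h1
    rw [h1]
    exact (F.starProjection_apply_mem w).2 a ha
  · rintro w ⟨hw, hwo⟩ hfix
    have : w ∈ F := ⟨hw, hfix⟩
    have h0 := (Submodule.mem_orthogonal F w).1 hwo w this
    exact inner_self_eq_zero.1 h0

/-- The key orthogonality: if `⁅x, Y⁆` is central on `W` and has no fixed vectors there then `x`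
moves the `Y`-fixed vectors to vectors orthogonal to the `Y`-fixed vectors. -/
lemma key_orth [CompleteSpace H] {ρ : Γ →* (H ≃ₗᵢ[ℂ] H)} {W : Submodule ℂ H}
    (hWc : IsClosed (W : Set H)) (hW : InvSub ρ W) (x : Γ) (Y : Subgroup Γ)
    (hcen : ∀ y ∈ Y, ∀ g : Γ, ⁅⁅x, y⁆, g⁆ ∈ fixer ρ W)
    (hnf : ∀ w ∈ W, (∀ y ∈ Y, ρ ⁅x, y⁆ w = w) → w = 0)
    (p q : H) (hp : p ∈ W ⊓ fixSub ρ (Y : Set Γ)) (hq : q ∈ W ⊓ fixSub ρ (Y : Set Γ)) :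
    inner ℂ q (ρ x p) = 0 := by
  set F := W ⊓ fixSub ρ (Y : Set Γ) with hF
  have hFc : IsClosed (F : Set H) := hWc.inter (fixSub_closed ρ _)
  have := hasProj_of_closed hFc
  set e := F.starProjection (ρ x p) with he
  have heF : e ∈ F := F.starProjection_apply_mem _
  have hin : ∀ r ∈ F, inner ℂ r (ρ x p) = inner ℂ r e := by
    intro r hr
    have := Submodule.starProjection_inner_eq_zero (K := F) (ρ x p) r hr
    rw [inner_eq_zero_symm, inner_sub_right, sub_eq_zero] at this
    exact this
  have hdF : ∀ y ∈ Y, ∀ r ∈ F, ρ ⁅x, y⁆ r ∈ F := by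
    intro y hy r hr
    refine ⟨hW _ _ hr.1, fun z hz => ?_⟩
    rw [← comm_of_fixer hW (hcen y hy z) hr.1, hr.2 z hz]
  have hstep : ∀ y ∈ Y, ∀ r ∈ F, inner ℂ (ρ ⁅x, y⁆ r) (ρ x p) = inner ℂ r (ρ x p) := by
    intro y hy r hr
    rw [rho_inner']
    have h1 : ρ ⁅x, y⁆⁻¹ (ρ x p) = ρ y (ρ x p) := by
      have hyp : ρ y⁻¹ p = p := hp.2 _ (Y.inv_mem hy)
      conv_rhs => rw [← hyp]
      rw [← rho_mul, ← rho_mul, ← rho_mul]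
      congr 2
      rw [commutatorElement_def]; group
    rw [h1]
    conv_lhs => rw [← hr.2 y hy]
    exact rho_inner ρ y r (ρ x p)
  have hefix : ∀ y ∈ Y, ρ ⁅x, y⁆ e = e := by
    intro y hy
    have hmem := hdF y hy e heF
    have h1 : inner ℂ (ρ ⁅x, y⁆ e) e = inner ℂ e e := by
      rw [← hin _ hmem, ← hin _ heF, hstep y hy e heF]
    have h2 : inner ℂ e (ρ ⁅x, y⁆ e) = inner ℂ e e := by
      rw [← inner_conj_symm, h1, inner_conj_symm]
    have h3 : inner ℂ (ρ ⁅x, y⁆ e - e) (ρ ⁅x, y⁆ e - e) = 0 := by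
      rw [inner_sub_left, inner_sub_right, inner_sub_right, rho_inner, h1, h2]; ring
    exact sub_eq_zero.1 (inner_self_eq_zero.1 h3)
  have he0 : e = 0 := hnf e heF.1 hefix
  rw [hin q hq, he0, inner_zero_right]

/-- Quantitative consequence of orthogonality. -/
lemma key_estimate [CompleteSpace H] (ρ : Γ →* (H ≃ₗᵢ[ℂ] H)) {F : Submodule ℂ H}
    (hFc : IsClosed (F : Set H)) (x : Γ)
    (horth : ∀ p ∈ F, inner ℂ p (ρ x p) = 0) (u p : H) (hp : p ∈ F) (d e : ℝ)
    (hd : ‖u - p‖ ≤ d) (he : ‖ρ x u - u‖ ≤ e) :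
    2 * (‖u‖ ^ 2 - d ^ 2) ≤ (2 * d + e) ^ 2 := by
  have := hasProj_of_closed hFc
  set q := F.starProjection u with hq
  have hqF : q ∈ F := F.starProjection_apply_mem _
  have hort : u - q ∈ Fᗮ := Submodule.sub_starProjection_mem_orthogonal u
  have h0 : ∀ r ∈ F, inner ℂ r (u - q) = 0 := fun r hr => (Submodule.mem_orthogonal F _).1 hort r hr
  have h1 : ‖u‖ ^ 2 = ‖q‖ ^ 2 + ‖u - q‖ ^ 2 := by
    have := norm_add_sq_eq_norm_sq_add_norm_sq_of_inner_eq_zero q (u - q) (h0 q hqF)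
    rw [add_sub_cancel] at this
    nlinarith [this]
  have h2 : ‖u - p‖ ^ 2 = ‖q - p‖ ^ 2 + ‖u - q‖ ^ 2 := by
    have := norm_add_sq_eq_norm_sq_add_norm_sq_of_inner_eq_zero (q - p) (u - q)
      (h0 _ (F.sub_mem hqF hp))
    have h : q - p + (u - q) = u - p := by abel
    rw [h] at this
    nlinarith [this]
  have h3 : ‖u - q‖ ≤ d := by
    refine le_trans ?_ hd
    exact abs_le_of_sq_le_sq' (by nlinarith [sq_nonneg ‖q - p‖]) (norm_nonneg _) |>.2
  have h4 : ‖ρ x q - q‖ ^ 2 = 2 * ‖q‖ ^ 2 := by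
    have := norm_sub_sq (𝕜 := ℂ) (ρ x q) q
    rw [inner_eq_zero_symm.1 (horth q hqF), rho_norm] at this
    simp at this
    linarith
  have h5 : ‖ρ x q - q‖ ≤ 2 * d + e := by
    have h : ρ x q - q = -(ρ x (u - q)) + (ρ x u - u) + (u - q) := by
      rw [map_sub]; abel
    rw [h]
    calc _ ≤ ‖-(ρ x (u - q))‖ + ‖ρ x u - u‖ + ‖u - q‖ := norm_add₃_le
      _ = ‖u - q‖ + ‖ρ x u - u‖ + ‖u - q‖ := by rw [norm_neg, rho_norm]
      _ ≤ _ := by linarith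
  have h6 : ‖ρ x q - q‖ ^ 2 ≤ (2 * d + e) ^ 2 := pow_le_pow_left₀ (norm_nonneg _) h5 2
  have h7 : ‖u - q‖ ^ 2 ≤ d ^ 2 := pow_le_pow_left₀ (norm_nonneg _) h3 2
  linarith

lemma disp_le (ρ : Γ →* (H ≃ₗᵢ[ℂ] H)) (x : Γ) (u p : H) (d : ℝ) (hp : ρ x p = p)
    (hd : ‖u - p‖ ≤ d) : ‖ρ x u - u‖ ≤ 2 * d := by
  have h : ρ x u - u = ρ x (u - p) - (u - p) := by rw [map_sub, hp]; abel
  rw [h]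
  calc _ ≤ ‖ρ x (u - p)‖ + ‖u - p‖ := norm_sub_le _ _
    _ ≤ _ := by rw [rho_norm]; linarith

lemma disp_mul (ρ : Γ →* (H ≃ₗᵢ[ℂ] H)) (x y : Γ) (u : H) :
    ‖ρ (x * y) u - u‖ ≤ ‖ρ x u - u‖ + ‖ρ y u - u‖ := by
  have h : ρ (x * y) u - u = ρ x (ρ y u - u) + (ρ x u - u) := by rw [rho_mul, map_sub]; abel
  rw [h]
  calc _ ≤ ‖ρ x (ρ y u - u)‖ + ‖ρ x u - u‖ := norm_add_le _ _
    _ = _ := by rw [rho_norm, add_comm]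

lemma disp_inv (ρ : Γ →* (H ≃ₗᵢ[ℂ] H)) (x : Γ) (u : H) :
    ‖ρ x⁻¹ u - u‖ = ‖ρ x u - u‖ := by
  have h : ρ x⁻¹ u - u = -(ρ x⁻¹ (ρ x u - u)) := by rw [map_sub, rho_inv_self]; abel
  rw [h, norm_neg, rho_norm]

lemma disp_comm (ρ : Γ →* (H ≃ₗᵢ[ℂ] H)) (x y : Γ) (u : H) :
    ‖ρ ⁅x, y⁆ u - u‖ ≤ 2 * ‖ρ x u - u‖ + 2 * ‖ρ y u - u‖ := by
  rw [commutatorElement_def]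
  have h1 := disp_mul ρ (x * y * x⁻¹) y⁻¹ u
  have h2 := disp_mul ρ (x * y) x⁻¹ u
  have h3 := disp_mul ρ x y u
  rw [disp_inv] at h1 h2
  linarith

/-- A condition on commutators with generators suffices. -/
lemma comm_mem_of_gen (K : Subgroup Γ) [K.Normal] (x : Γ) (P : Subgroup Γ) (hP : P = ⊤)
    {ι : Type*} (R : Set ι) (Y : ι → Subgroup Γ) (hle : P ≤ ⨆ i ∈ R, Y i)
    (h : ∀ i ∈ R, ∀ y ∈ Y i, ⁅x, y⁆ ∈ K) (g : Γ) : ⁅x, g⁆ ∈ K := by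
  have key : (⨆ i ∈ R, Y i) ≤ (Subgroup.centralizer {QuotientGroup.mk' K x}).comap
      (QuotientGroup.mk' K) := by
    refine iSup₂_le fun i hi y hy => ?_
    rw [Subgroup.mem_comap, Subgroup.mem_centralizer_singleton_iff]
    have := h i hi y hy
    rw [← QuotientGroup.eq_one_iff] at this
    have h2 : ⁅QuotientGroup.mk' K x, QuotientGroup.mk' K y⁆ = 1 := by
      rw [← map_commutatorElement]; exact this
    rw [commutatorElement_eq_one_iff_mul_comm] at h2
    exact h2.symm
  have hg : g ∈ (⨆ i ∈ R, Y i) := hle (hP ▸ Subgroup.mem_top g)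
  have := key hg
  rw [Subgroup.mem_comap, Subgroup.mem_centralizer_singleton_iff] at this
  rw [← QuotientGroup.eq_one_iff]
  have h2 : ⁅QuotientGroup.mk' K x, QuotientGroup.mk' K g⁆ = 1 := by
    rw [commutatorElement_eq_one_iff_mul_comm]; exact this.symm
  rw [← map_commutatorElement] at h2
  exact h2

lemma step_normal (K : Subgroup Γ) [K.Normal] : (Subgroup.upperCentralSeriesStep K).Normal := by
  rw [Subgroup.upperCentralSeriesStep_eq_comap_center]
  infer_instance

end RepPart
/-! ### From local to global -/

section LocalGlobal

variable {Γ : Type*} [Group Γ] {H : Type*} [NormedAddCommGroup H] [InnerProductSpace ℂ H]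

/-- The codistance inequality on the subspace `W`. -/
def IneqOn (ρ : Γ →* (H ≃ₗᵢ[ℂ] H)) {ι : Type*} (s : Finset ι) (A : ι → Set Γ) (C : ℝ)
    (W : Submodule ℂ H) : Prop :=
  ∀ v : ι → H, (∀ i ∈ s, v i ∈ W ∧ v i ∈ fixSub ρ (A i)) →
    ‖∑ i ∈ s, v i‖ ^ 2 ≤ C * ∑ i ∈ s, ‖v i‖ ^ 2

lemma fixSub_proj {ρ : Γ →* (H ≃ₗᵢ[ℂ] H)} {W : Submodule ℂ H} [W.HasOrthogonalProjection]
    (hW : InvSub ρ W) (A : Set Γ) {w : H} (hw : w ∈ fixSub ρ A) :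
    W.starProjection w ∈ fixSub ρ A := by
  intro a ha
  rw [proj_comm hW, hw a ha]

lemma closure_inv {ρ : Γ →* (H ≃ₗᵢ[ℂ] H)} {W : Submodule ℂ H} (hW : InvSub ρ W) :
    InvSub ρ W.topologicalClosure := by
  intro g w hw
  have h : Set.MapsTo (ρ g) (W : Set H) (W : Set H) := fun w hw => hW g w hw
  exact h.closure (ρ g).continuous hw

lemma iSup_inv {ρ : Γ →* (H ≃ₗᵢ[ℂ] H)} {ι : Type*} {U : ι → Submodule ℂ H}
    (hU : ∀ i, InvSub ρ (U i)) : InvSub ρ (⨆ i, U i) := by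
  intro g w hw
  have : (⨆ i, U i) ≤ (⨆ i, U i).comap (ρ g).toLinearEquiv.toLinearMap :=
    iSup_le fun i w hw => Submodule.mem_comap.2 (Submodule.mem_iSup_of_mem i (hU i g w hw))
  exact this hw

lemma local_global [CompleteSpace H] (ρ : Γ →* (H ≃ₗᵢ[ℂ] H)) {ι : Type*} (s : Finset ι)
    (A : ι → Set Γ) (C : ℝ)
    (hloc : ∀ W : Submodule ℂ H, IsClosed (W : Set H) → InvSub ρ W → W ≠ ⊥ →
      ∃ W' : Submodule ℂ H, W' ≤ W ∧ IsClosed (W' : Set H) ∧ InvSub ρ W' ∧ W' ≠ ⊥ ∧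
        IneqOn ρ s A C W') :
    IneqOn ρ s A C ⊤ := by
  obtain ⟨W, -, hWmax⟩ := zorn_le_nonempty₀
    {W : Submodule ℂ H | IsClosed (W : Set H) ∧ InvSub ρ W ∧ IneqOn ρ s A C W} (by
      intro c hc hchain y hy
      have hcl : ∀ i : c, IsClosed ((i : Submodule ℂ H) : Set H) := fun i => (hc i.2).1
      have hinv : ∀ i : c, InvSub ρ (i : Submodule ℂ H) := fun i => (hc i.2).2.1
      have hproj : ∀ i : c, (i : Submodule ℂ H).HasOrthogonalProjection :=
        fun i => hasProj_of_closed (hcl i)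
      set T := (⨆ i : c, (i : Submodule ℂ H)).topologicalClosure with hT
      have hTc : IsClosed (T : Set H) := Submodule.isClosed_topologicalClosure _
      have := hasProj_of_closed hTc
      have : Nonempty c := ⟨⟨y, hy⟩⟩
      have : IsDirectedOrder c := ⟨by
        intro a b
        rcases hchain.total a.2 b.2 with h | h
        · exact ⟨b, h, le_rfl⟩
        · exact ⟨a, le_rfl, h⟩⟩
      refine ⟨T, ⟨hTc, closure_inv (iSup_inv hinv), ?_⟩, ?_⟩
      · intro v hv
        have hlim : ∀ i ∈ s, Filter.Tendsto (fun k : c => (k : Submodule ℂ H).starProjection (v i))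
            Filter.atTop (nhds (v i)) := by
          intro i hi
          have h := Submodule.starProjection_tendsto_closure_iSup
            (fun k : c => (k : Submodule ℂ H)) (fun a b h => h) (v i)
          rwa [Submodule.starProjection_eq_self_iff.2 (hv i hi).1] at h
        refine le_of_tendsto_of_tendsto' ((tendsto_finsetSum s hlim).norm.pow 2)
          ((tendsto_finsetSum s fun i hi => (hlim i hi).norm.pow 2).const_mul C) ?_
        intro k
        exact (hc k.2).2.2 _ fun i hi => ⟨Submodule.starProjection_apply_mem _ _,
          fixSub_proj (hinv k) _ (hv i hi).2⟩
      · intro z hz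
        exact le_trans (le_iSup (fun i : c => (i : Submodule ℂ H)) ⟨z, hz⟩)
          (Submodule.le_topologicalClosure _)) ⊥ ⟨by simp, by
        intro g w hw
        rw [Submodule.mem_bot] at hw ⊢
        rw [hw, map_zero], by
        intro v hv
        have h0 : ∀ i ∈ s, v i = 0 := fun i hi => (Submodule.mem_bot ℂ).1 (hv i hi).1
        rw [Finset.sum_eq_zero h0, Finset.sum_eq_zero (fun i hi => by rw [h0 i hi]; simp)]
        simp⟩
  obtain ⟨hWc, hWi, hWq⟩ := hWmax.prop
  have hpr := hasProj_of_closed hWc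
  by_cases hbot : Wᗮ = ⊥
  · have : W = ⊤ := by
      rwa [Submodule.orthogonal_eq_bot_iff] at hbot
    rwa [this] at hWq
  exfalso
  obtain ⟨W', hle, hc', hi', hne', hq'⟩ := hloc Wᗮ W.isClosed_orthogonal hWi.orth hbot
  set T : Submodule ℂ H := W'.comap
    (LinearMap.id - (W.starProjection : H →L[ℂ] H).toLinearMap) with hT
  have hmemT : ∀ w, w ∈ T ↔ w - W.starProjection w ∈ W' := fun w => Iff.rfl
  have hTS : IsClosed (T : Set H) ∧ InvSub ρ T ∧ IneqOn ρ s A C T := by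
    refine ⟨?_, ?_, ?_⟩
    · have hcont : Continuous fun w : H => w - W.starProjection w := by fun_prop
      exact hc'.preimage hcont
    · intro g w hw
      rw [hmemT] at hw ⊢
      rw [← proj_comm hWi, ← map_sub]
      exact hi' g _ hw
    · intro v hv
      have h1 := hWq (fun i => W.starProjection (v i)) fun i hi =>
        ⟨Submodule.starProjection_apply_mem _ _, fixSub_proj hWi _ (hv i hi).2⟩
      have h2 := hq' (fun i => v i - W.starProjection (v i)) fun i hi =>
        ⟨(hmemT _).1 (hv i hi).1, Submodule.sub_mem _ (hv i hi).2 (fixSub_proj hWi _ (hv i hi).2)⟩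
      have hpyth : ∀ w : H, ‖w‖ ^ 2 = ‖W.starProjection w‖ ^ 2 + ‖w - W.starProjection w‖ ^ 2 := by
        intro w
        have h0 : inner ℂ (W.starProjection w) (w - W.starProjection w) = 0 :=
          (Submodule.mem_orthogonal W _).1 (Submodule.sub_starProjection_mem_orthogonal w) _
            (Submodule.starProjection_apply_mem _ _)
        have := norm_add_sq_eq_norm_sq_add_norm_sq_of_inner_eq_zero _ _ h0
        rw [add_sub_cancel] at this
        nlinarith [this]
      rw [hpyth (∑ i ∈ s, v i), Finset.sum_congr rfl fun i _ => hpyth (v i),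
        Finset.sum_add_distrib, map_sum, ← Finset.sum_sub_distrib, mul_add]
      exact add_le_add h1 h2
  have hWT : W ≤ T := by
    intro w hw
    rw [hmemT, Submodule.starProjection_eq_self_iff.2 hw, sub_self]
    exact W'.zero_mem
  have hTW : T ≤ W := hWmax.le_of_ge hTS hWT
  apply hne'
  rw [Submodule.eq_bot_iff]
  intro w hw
  have hwT : w ∈ T := by
    rw [hmemT, W.starProjection_apply_eq_zero_iff.2 (hle hw), sub_zero]
    exact hw
  have := (Submodule.mem_orthogonal W w).1 (hle hw) w (hTW hwT)
  exact inner_self_eq_zero.1 this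

end LocalGlobal
/-! ### Combinatorics of Borel sets -/

section Combi

variable {E : Type*} [AddCommGroup E] [Module ℝ E]

lemma eventually_ne_aux (a b : ℝ) (hb : b ≠ 0) :
    ∀ᶠ t in nhdsWithin (0 : ℝ) (Set.Ioi 0), a + t * b ≠ 0 := by
  by_cases ha : a = 0
  · filter_upwards [self_mem_nhdsWithin] with t ht
    have : (0 : ℝ) < t := ht
    rw [ha, zero_add]
    exact mul_ne_zero this.ne' hb
  · have hc : Filter.Tendsto (fun t : ℝ => a + t * b) (nhdsWithin 0 (Set.Ioi 0)) (nhds a) := by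
      have : Continuous fun t : ℝ => a + t * b := by fun_prop
      have h := this.tendsto 0
      simp only [zero_mul, add_zero] at h
      exact h.mono_left nhdsWithin_le_nhds
    exact hc.eventually_ne ha

lemma eventually_pos_aux (a b : ℝ) (ha : 0 < a) :
    ∀ᶠ t in nhdsWithin (0 : ℝ) (Set.Ioi 0), 0 < a + t * b := by
  have hc : Filter.Tendsto (fun t : ℝ => a + t * b) (nhdsWithin 0 (Set.Ioi 0)) (nhds a) := by
    have : Continuous fun t : ℝ => a + t * b := by fun_prop
    have h := this.tendsto 0
    simp only [zero_mul, add_zero] at h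
    exact h.mono_left nhdsWithin_le_nhds
  exact hc.eventually (lt_mem_nhds ha)

/-- Any functional can be perturbed to a regular one. -/
lemma exists_regular {Φ : Set E} (hfin : Φ.Finite) {f : E →ₗ[ℝ] ℝ} (hf : IsRegularFunc Φ f)
    (g₀ : E →ₗ[ℝ] ℝ) :
    ∃ g : E →ₗ[ℝ] ℝ, IsRegularFunc Φ g ∧
      ∀ α ∈ Φ, (0 < g₀ α → 0 < g α) ∧ (g₀ α < 0 → g α < 0) := by
  have h1 : ∀ᶠ t in nhdsWithin (0 : ℝ) (Set.Ioi 0), ∀ α ∈ Φ, g₀ α + t * f α ≠ 0 :=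
    (Filter.eventually_all_finite hfin).2 fun α hα => eventually_ne_aux _ _ (hf.1 α hα)
  have h2 : ∀ᶠ t in nhdsWithin (0 : ℝ) (Set.Ioi 0), ∀ α ∈ Φ, ∀ β ∈ Φ, α ≠ β →
      (g₀ α - g₀ β) + t * (f α - f β) ≠ 0 := by
    refine (Filter.eventually_all_finite hfin).2 fun α hα =>
      (Filter.eventually_all_finite hfin).2 fun β hβ => ?_
    by_cases hab : α = β
    · exact Filter.Eventually.of_forall fun t h => (h hab).elim
    · filter_upwards [eventually_ne_aux (g₀ α - g₀ β) (f α - f β)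
        (sub_ne_zero.2 (hf.2 α hα β hβ hab))] with t ht _
      exact ht
  have h3 : ∀ᶠ t in nhdsWithin (0 : ℝ) (Set.Ioi 0), ∀ α ∈ Φ,
      (0 < g₀ α → 0 < g₀ α + t * f α) := by
    refine (Filter.eventually_all_finite hfin).2 fun α hα => ?_
    by_cases h : 0 < g₀ α
    · filter_upwards [eventually_pos_aux _ (f α) h] with t ht _
      exact ht
    · exact Filter.Eventually.of_forall fun t h' => (h h').elim
  have h4 : ∀ᶠ t in nhdsWithin (0 : ℝ) (Set.Ioi 0), ∀ α ∈ Φ,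
      (g₀ α < 0 → 0 < - g₀ α + t * (- f α)) := by
    refine (Filter.eventually_all_finite hfin).2 fun α hα => ?_
    by_cases h : g₀ α < 0
    · filter_upwards [eventually_pos_aux (- g₀ α) (- f α) (by linarith)] with t ht _
      exact ht
    · exact Filter.Eventually.of_forall fun t h' => (h h').elim
  obtain ⟨t, ht1, ht2, ht3, ht4⟩ := (h1.and (h2.and (h3.and h4))).exists
  refine ⟨g₀ + t • f, ⟨?_, ?_⟩, ?_⟩
  · intro α hα
    simpa using ht1 α hα
  · intro α hα β hβ hab heq
    apply ht2 α hα β hβ hab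
    simp only [LinearMap.add_apply, LinearMap.smul_apply, smul_eq_mul] at heq
    linarith
  · intro α hα
    simp only [LinearMap.add_apply, LinearMap.smul_apply, smul_eq_mul]
    refine ⟨ht3 α hα, fun h => ?_⟩
    have := ht4 α hα h
    linarith

/-- Separating two non-proportional vectors. -/
lemma exists_sep {α β : E} (hα : α ≠ 0) (h : ¬ ∃ c : ℝ, β = c • α) :
    ∃ g : E →ₗ[ℝ] ℝ, g α = -1 ∧ g β = 1 := by
  by_cases hα0 : ∃ c : ℝ, α = c • β
  · exfalso
    obtain ⟨c, hc⟩ := hα0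
    by_cases hc0 : c = 0
    · exact hα (by rw [hc, hc0, zero_smul])
    · exact h ⟨c⁻¹, by rw [hc, smul_smul, inv_mul_cancel₀ hc0, one_smul]⟩
  have h1 : β ∉ Submodule.span ℝ {α} := by
    rw [Submodule.mem_span_singleton]
    rintro ⟨c, hc⟩
    exact h ⟨c, hc.symm⟩
  have h2 : α ∉ Submodule.span ℝ {β} := by
    rw [Submodule.mem_span_singleton]
    rintro ⟨c, hc⟩
    exact hα0 ⟨c, hc.symm⟩
  obtain ⟨p, hp, hpk⟩ := Submodule.exists_le_ker_of_notMem h1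
  obtain ⟨q, hq, hqk⟩ := Submodule.exists_le_ker_of_notMem h2
  have hp0 : p α = 0 := hpk (Submodule.mem_span_singleton_self α)
  have hq0 : q β = 0 := hqk (Submodule.mem_span_singleton_self β)
  refine ⟨(p β)⁻¹ • p - (q α)⁻¹ • q, ?_, ?_⟩
  · simp [hp0, hq]
  · simp [hq0, hp]

/-- One half of the analysis of co-maximality. -/
lemma comax_aux {Φ : Set E} (hΦ : IsRootSystem Φ) {f g : E →ₗ[ℝ] ℝ} (hf : IsRegularFunc Φ f)
    (hco : CoMaximal Φ (borelSet Φ f) (borelSet Φ g)) {α β : E}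
    (hα : α ∈ borelSet Φ f) (hβ : β ∈ borelSet Φ f) (hαg : α ∉ borelSet Φ g)
    (hβg : β ∉ borelSet Φ g) (g₀ : E →ₗ[ℝ] ℝ)
    (hpos : ∀ γ ∈ borelSet Φ f ∩ borelSet Φ g, 0 < g₀ γ) (h1 : 0 < g₀ α) (h2 : g₀ β < 0) :
    False := by
  obtain ⟨h, hreg, hsign⟩ := exists_regular hΦ.finite hf g₀
  rcases hco (borelSet Φ h) ⟨h, hreg, rfl⟩
    (fun γ hγ => ⟨hγ.1.1, (hsign γ hγ.1.1).1 (hpos γ hγ)⟩) with heq | heq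
  · rw [← heq] at hβ
    exact absurd hβ.2 (not_lt.2 ((hsign β hβ.1).2 h2).le)
  · rw [← heq] at hαg
    exact hαg ⟨hα.1, (hsign α hα.1).1 h1⟩

lemma comax_parallel {Φ : Set E} (hΦ : IsRootSystem Φ) {f g : E →ₗ[ℝ] ℝ} (hf : IsRegularFunc Φ f)
    (hg : IsRegularFunc Φ g)
    (hco : CoMaximal Φ (borelSet Φ f) (borelSet Φ g)) {α β : E}
    (hα : α ∈ borelSet Φ f) (hβ : β ∈ borelSet Φ f) (hαg : α ∉ borelSet Φ g)
    (hβg : β ∉ borelSet Φ g) : ∃ c : ℝ, β = c • α := by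
  by_contra hpar
  have hα0 : α ≠ 0 := fun h => hΦ.zero_notMem (h ▸ hα.1)
  have hβ0 : β ≠ 0 := fun h => hΦ.zero_notMem (h ▸ hβ.1)
  obtain ⟨k, hkα, hkβ⟩ := exists_sep hα0 hpar
  have hgα : g α < 0 := lt_of_le_of_ne (not_lt.1 fun h => hαg ⟨hα.1, h⟩) (hg.1 α hα.1)
  have hfα : 0 < f α := hα.2
  set t := f α / (- g α) with ht
  have ht0 : 0 < t := div_pos hfα (by linarith)
  have htα : f α + t * g α = 0 := by
    have := hgα.ne
    rw [ht]; field_simp; ring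
  have hpos : ∀ γ ∈ borelSet Φ f ∩ borelSet Φ g, 0 < f γ + t * g γ := by
    rintro γ ⟨h1, h2⟩
    have h1' : 0 < f γ := h1.2
    have h2' : 0 < g γ := h2.2
    positivity
  have hfin : (borelSet Φ f ∩ borelSet Φ g).Finite :=
    hΦ.finite.subset fun γ hγ => hγ.1.1
  have hev : ∀ b : ℝ, ∃ s : ℝ, 0 < s ∧ ∀ γ ∈ borelSet Φ f ∩ borelSet Φ g,
      0 < (f γ + t * g γ) + s * (b * k γ) := by
    intro b
    have h1 : ∀ᶠ s in nhdsWithin (0 : ℝ) (Set.Ioi 0), ∀ γ ∈ borelSet Φ f ∩ borelSet Φ g,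
        0 < (f γ + t * g γ) + s * (b * k γ) :=
      (Filter.eventually_all_finite hfin).2 fun γ hγ => eventually_pos_aux _ _ (hpos γ hγ)
    have h2 : ∀ᶠ s in nhdsWithin (0 : ℝ) (Set.Ioi 0), 0 < s := self_mem_nhdsWithin
    exact (h2.and h1).exists
  rcases le_total (f β + t * g β) 0 with hle | hle
  · obtain ⟨s, hs, hs'⟩ := hev (-1)
    refine comax_aux hΦ hf hco hα hβ hαg hβg (f + t • g + s • (-k)) ?_ ?_ ?_
    · intro γ hγ
      have := hs' γ hγ
      simp; linarith
    · simp [hkα]; linarith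
    · simp [hkβ]; linarith
  · obtain ⟨s, hs, hs'⟩ := hev 1
    refine comax_aux hΦ hf hco hβ hα hβg hαg (f + t • g + s • k) ?_ ?_ ?_
    · intro γ hγ
      have := hs' γ hγ
      simp; linarith
    · simp [hkβ]; linarith
    · simp [hkα]; linarith

/-- Positive multiples of boundary roots are boundary roots. -/
lemma boundary_smul {Φ : Set E} {f : E →ₗ[ℝ] ℝ} {α β : E}
    (hα : α ∈ borelBoundary Φ f) (hβ : β ∈ borelSet Φ f) (c : ℝ) (hc : β = c • α) :
    β ∈ borelBoundary Φ f := by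
  simp only [borelBoundary, Set.mem_iUnion, Set.mem_ofPred_eq] at hα ⊢
  obtain ⟨B, ⟨hB, hco⟩, hαf, hαB⟩ := hα
  refine ⟨B, ⟨hB, hco⟩, hβ, ?_⟩
  obtain ⟨g, hg, rfl⟩ := hB
  rintro ⟨-, hβg⟩
  have hfα : 0 < f α := hαf.2
  have hfβ : 0 < f β := hβ.2
  rw [hc, map_smul, smul_eq_mul] at hfβ hβg
  have hc0 : 0 < c := pos_of_mul_pos_left hfβ hfα.le
  exact hαB ⟨hαf.1, pos_of_mul_pos_right hβg hc0.le⟩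

lemma core_smul {Φ : Set E} (hΦ : IsRootSystem Φ) {f : E →ₗ[ℝ] ℝ} {α β : E}
    (hα : α ∈ borelCore Φ f) (hβ : β ∈ borelSet Φ f) (c : ℝ) (hc : β = c • α) :
    β ∈ borelCore Φ f := by
  refine ⟨hβ, fun hb => hα.2 ?_⟩
  have hc0 : c ≠ 0 := by
    rintro rfl
    rw [zero_smul] at hc
    exact hΦ.zero_notMem (hc ▸ hβ.1)
  exact boundary_smul hb hα.1 c⁻¹ (by rw [hc, smul_smul, inv_mul_cancel₀ hc0, one_smul])

/-- A boundary root spans an extremal ray. -/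
lemma boundary_ideal {Φ : Set E} (hΦ : IsRootSystem Φ) {f : E →ₗ[ℝ] ℝ} (hf : IsRegularFunc Φ f)
    {α : E} (hα : α ∈ borelBoundary Φ f) {β γ δ : E} (hβ : β ∈ borelSet Φ f)
    (hβα : ¬ ∃ c : ℝ, β = c • α) (hγ : γ ∈ borelSet Φ f) (hδ : δ ∈ borelSet Φ f)
    {a b : ℝ} (ha : 1 ≤ a) (hb : 1 ≤ b) (h : δ = a • β + b • γ) : ¬ ∃ c : ℝ, δ = c • α := by
  simp only [borelBoundary, Set.mem_iUnion, Set.mem_ofPred_eq] at hα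
  obtain ⟨B, ⟨⟨g, hg, rfl⟩, hco⟩, hαf, hαB⟩ := hα
  rintro ⟨c, hc⟩
  have ha0 : a ≠ 0 := by linarith
  by_cases hγα : ∃ c : ℝ, γ = c • α
  · obtain ⟨c', hc'⟩ := hγα
    apply hβα
    refine ⟨a⁻¹ * (c - b * c'), ?_⟩
    have h1 : a • β = (c - b * c') • α := by
      rw [sub_smul, mul_smul, ← hc, ← hc', h]; abel
    rw [mul_smul, ← h1, smul_smul, inv_mul_cancel₀ ha0, one_smul]
  · have key : ∀ x ∈ borelSet Φ f, (¬ ∃ c : ℝ, x = c • α) → 0 < g x := by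
      intro x hx hxα
      by_contra hneg
      exact hxα (comax_parallel hΦ hf hg hco hαf hx hαB fun h => hneg h.2)
    have h1 := key β hβ hβα
    have h2 := key γ hγ hγα
    have hgδ : 0 < g δ := by
      rw [h]; simp only [map_add, map_smul, smul_eq_mul]; positivity
    have hfα : 0 < f α := hαf.2
    have hfδ : 0 < f δ := hδ.2
    rw [hc, map_smul, smul_eq_mul] at hfδ hgδ
    have hc0 : 0 < c := pos_of_mul_pos_left hfδ hfα.le
    exact hαB ⟨hαf.1, pos_of_mul_pos_right hgδ hc0.le⟩

end Combi
/-! ### Local existence of good subrepresentations -/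

section LocalPart

open scoped commutatorElement

variable {E : Type*} [AddCommGroup E] [Module ℝ E]

/-- The constant used in the local estimate. -/
noncomputable def kap (Φ : Set E) : ℝ := 1 / (4 ^ (Φ.ncard / 2 - 1) - 1)

lemma card_le_half {Φ : Set E} (hΦ : IsRootSystem Φ) (f : E →ₗ[ℝ] ℝ) (T : Finset E)
    (hT : ∀ x ∈ T, x ∈ borelSet Φ f) : T.card ≤ Φ.ncard / 2 := by
  classical
  have h1 : Disjoint T (T.image (fun x => -x)) := by
    rw [Finset.disjoint_left]
    intro x hx hx'
    obtain ⟨y, hy, hyx⟩ := Finset.mem_image.1 hx'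
    have h1 := (hT x hx).2
    have h2 := (hT y hy).2
    rw [← hyx, map_neg] at h1
    linarith
  have h2 : ((T ∪ T.image (fun x => -x) : Finset E) : Set E) ⊆ Φ := by
    intro x hx
    rcases Finset.mem_union.1 (Finset.mem_coe.1 hx) with h | h
    · exact (hT x h).1
    · obtain ⟨y, hy, rfl⟩ := Finset.mem_image.1 h
      exact hΦ.neg_mem y (hT y hy).1
  have h3 := Set.ncard_le_ncard h2 hΦ.finite
  rw [Set.ncard_coe_finset, Finset.card_union_of_disjoint h1,
    Finset.card_image_of_injective _ neg_injective] at h3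
  omega

lemma kap_le {Φ : Set E} (k : ℕ) (hk : 2 ≤ k) (h : k ≤ Φ.ncard / 2) :
    kap Φ ≤ 1 / (4 ^ (k - 1) - 1) := by
  unfold kap
  have h1 : (4 : ℝ) ^ (k - 1) ≤ 4 ^ (Φ.ncard / 2 - 1) :=
    pow_le_pow_right₀ (by norm_num) (by omega)
  have h2 : (4 : ℝ) ^ 1 ≤ 4 ^ (k - 1) := pow_le_pow_right₀ (by norm_num) (by omega)
  apply one_div_le_one_div_of_le <;> linarith

lemma kap_nonneg (Φ : Set E) : 0 ≤ kap Φ := by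
  unfold kap
  have : (1 : ℝ) ≤ 4 ^ (Φ.ncard / 2 - 1) := one_le_pow₀ (by norm_num)
  apply div_nonneg <;> linarith

lemma exists_max_f {Φ : Set E} (hΦ : IsRootSystem Φ) (f : E →ₗ[ℝ] ℝ) (P : E → Prop)
    (hP : ∀ x, P x → x ∈ Φ) (hne : ∃ x, P x) : ∃ x, P x ∧ ∀ y, f x < f y → ¬ P y := by
  have hfin : {x | P x}.Finite := hΦ.finite.subset hP
  obtain ⟨x, hx, hmax⟩ := Set.exists_max_image {x | P x} f hfin hne
  exact ⟨x, hx, fun y hy hPy => absurd (hmax y hPy) (not_le.2 hy)⟩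

variable {Γ : Type*} [Group Γ]

/-- The transported strong grading on the group `Γ = G_f`. -/
structure StrongSys (Φ : Set E) (f : E →ₗ[ℝ] ℝ) (Y : E → Subgroup Γ) : Prop where
  root : IsRootSystem Φ
  reg : IsRegularFunc Φ f
  gen : (⨆ α ∈ borelSet Φ f, Y α) = ⊤
  comm : ∀ α ∈ borelSet Φ f, ∀ β ∈ borelSet Φ f, ⁅Y α, Y β⁆ ≤
    ⨆ γ ∈ {γ ∈ borelSet Φ f | ∃ a b : ℝ, 1 ≤ a ∧ 1 ≤ b ∧ γ = a • α + b • β}, Y γ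
  str : ∀ γ ∈ borelCore Φ f, Y γ ≤ ⨆ β ∈ {β ∈ borelSet Φ f | ¬ ∃ c : ℝ, β = c • γ}, Y β

variable {Φ : Set E} {f : E →ₗ[ℝ] ℝ} {Y : E → Subgroup Γ}

lemma f_big {α β γ : E} (hα : α ∈ borelSet Φ f) (hβ : β ∈ borelSet Φ f) {a b : ℝ} (ha : 1 ≤ a)
    (hb : 1 ≤ b) (h : γ = a • α + b • β) : f α < f γ ∧ f β < f γ := by
  have h1 : 0 < f α := hα.2
  have h2 : 0 < f β := hβ.2
  have h3 : f γ = a * f α + b * f β := by rw [h]; simp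
  constructor <;> nlinarith

lemma StrongSys.comm_mem (hS : StrongSys Φ f Y) (K : Subgroup Γ) {α β : E}
    (hα : α ∈ borelSet Φ f) (hβ : β ∈ borelSet Φ f)
    (h : ∀ γ ∈ borelSet Φ f, f α < f γ → f β < f γ →
      (∃ a b : ℝ, 1 ≤ a ∧ 1 ≤ b ∧ γ = a • α + b • β) → Y γ ≤ K)
    {x y : Γ} (hx : x ∈ Y α) (hy : y ∈ Y β) : ⁅x, y⁆ ∈ K := by
  have h1 := hS.comm α hα β hβ (Subgroup.commutator_mem_commutator hx hy)
  refine (iSup₂_le (fun γ hγ => ?_) : _ ≤ K) h1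
  obtain ⟨hγS, a, b, ha, hb, hab⟩ := hγ
  obtain ⟨h2, h3⟩ := f_big hα hβ ha hb hab
  exact h γ hγS h2 h3 ⟨a, b, ha, hb, hab⟩

/-- Non-parallel part when `α` is in the core: it generates. -/
lemma StrongSys.core_gen (hS : StrongSys Φ f Y) {α : E} (hα : α ∈ borelCore Φ f) :
    (⨆ β ∈ {β ∈ borelSet Φ f | ¬ ∃ c : ℝ, β = c • α}, Y β) = ⊤ := by
  rw [eq_top_iff, ← hS.gen]
  refine iSup₂_le fun γ hγ => ?_
  by_cases hpar : ∃ c : ℝ, γ = c • α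
  · obtain ⟨c, hc⟩ := hpar
    have hγc := core_smul hS.root hα hγ c hc
    refine (hS.str γ hγc).trans ?_
    refine iSup₂_le fun β hβ => ?_
    refine le_iSup₂_of_le (f := fun (β : E) (_ : β ∈ {β ∈ borelSet Φ f | ¬ ∃ c : ℝ, β = c • α}) => Y β)
      β ⟨hβ.1, ?_⟩ le_rfl
    rintro ⟨c', hc'⟩
    apply hβ.2
    have hc0 : c ≠ 0 := by
      rintro rfl
      rw [zero_smul] at hc
      exact hS.root.zero_notMem (hc ▸ hγ.1)
    exact ⟨c' * c⁻¹, by rw [hc, smul_smul, mul_assoc, inv_mul_cancel₀ hc0, mul_one, hc']⟩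
  · exact le_iSup₂_of_le (f := fun (β : E) (_ : β ∈ {β ∈ borelSet Φ f | ¬ ∃ c : ℝ, β = c • α}) => Y β)
      γ ⟨hγ, hpar⟩ le_rfl

variable {H : Type*} [NormedAddCommGroup H] [InnerProductSpace ℂ H]

/-- Good subrepresentations. -/
def GoodW (Φ : Set E) (f : E →ₗ[ℝ] ℝ) (Y : E → Subgroup Γ) (ρ : Γ →* (H ≃ₗᵢ[ℂ] H))
    (κ : ℝ) (W : Submodule ℂ H) : Prop :=
  ∃ α ∈ borelSet Φ f, (∀ w ∈ W, (∀ a ∈ Y α, ρ a w = w) → w = 0) ∧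
    ∀ u ∈ W, ∃ β ∈ borelSet Φ f, (¬ ∃ c : ℝ, β = c • α) ∧
      ∀ p ∈ W, (∀ b ∈ Y β, ρ b p = p) → κ * ‖u‖ ^ 2 ≤ ‖u - p‖ ^ 2

/-- The easy case: both `Y α` and `Y β` have no fixed vectors. -/
lemma good_of_two (hΦ : IsRootSystem Φ) {ρ : Γ →* (H ≃ₗᵢ[ℂ] H)} {W : Submodule ℂ H} {α β : E}
    (hα : α ∈ borelSet Φ f) (hβ : β ∈ borelSet Φ f) (hpar : ¬ ∃ c : ℝ, β = c • α)
    (h1 : ∀ w ∈ W, (∀ a ∈ Y α, ρ a w = w) → w = 0)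
    (h2 : ∀ w ∈ W, (∀ a ∈ Y β, ρ a w = w) → w = 0) : GoodW Φ f Y ρ (kap Φ) W := by
  classical
  refine ⟨α, hα, h1, fun u _ => ⟨β, hβ, hpar, fun p hp hpf => ?_⟩⟩
  rw [h2 p hp hpf, sub_zero]
  have hne : α ≠ β := fun h => hpar ⟨1, by rw [one_smul, h]⟩
  have hc := card_le_half hΦ f {α, β} (by
    intro x hx
    rcases Finset.mem_insert.1 hx with rfl | hx
    · exact hα
    · rw [Finset.mem_singleton.1 hx]; exact hβ)
  rw [Finset.card_pair hne] at hc
  have := kap_le 2 le_rfl hc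
  norm_num at this
  nlinarith [sq_nonneg ‖u‖]


/-- The commutator case. -/
lemma good_of_comm [CompleteSpace H] {ρ : Γ →* (H ≃ₗᵢ[ℂ] H)}
    {W : Submodule ℂ H} (hWc : IsClosed (W : Set H)) (hW : InvSub ρ W) {α δ : E}
    (hα : α ∈ borelSet Φ f) (hδ : δ ∈ borelSet Φ f) (hpar : ¬ ∃ c : ℝ, δ = c • α)
    (h1 : ∀ w ∈ W, (∀ a ∈ Y α, ρ a w = w) → w = 0) (x : Γ)
    (hx : ∀ y ∈ Y δ, ∀ g : Γ, ⁅⁅x, y⁆, g⁆ ∈ fixer ρ W)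
    (hne : ∃ y ∈ Y δ, ⁅x, y⁆ ∉ fixer ρ W) (e κ : ℝ)
    (hκ0 : 0 ≤ κ) (hκ : κ * (2 + (2 + e) ^ 2) < 2)
    (hdisp : ∀ (u : H) (d : ℝ), (∀ β ∈ borelSet Φ f, (¬ ∃ c : ℝ, β = c • α) →
      ∃ p, (∀ b ∈ Y β, ρ b p = p) ∧ ‖u - p‖ ≤ d) → ‖ρ x u - u‖ ≤ e * d) :
    ∃ W' : Submodule ℂ H, W' ≤ W ∧ IsClosed (W' : Set H) ∧ InvSub ρ W' ∧ W' ≠ ⊥ ∧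
      GoodW Φ f Y ρ κ W' := by
  obtain ⟨W', hle, hc', hi', hne', hnf⟩ := split_fix hWc hW {z | ∃ y ∈ Y δ, z = ⁅x, y⁆}
    (by rintro a ⟨y, hy, rfl⟩ g; exact hx y hy g)
    (by obtain ⟨y, hy, hy'⟩ := hne; exact ⟨_, ⟨y, hy, rfl⟩, hy'⟩)
  refine ⟨W', hle, hc', hi', hne', α, hα, fun w hw => h1 w (hle hw), fun u hu => ?_⟩
  by_cases hu0 : u = 0
  · refine ⟨δ, hδ, hpar, fun p _ _ => ?_⟩
    rw [hu0, norm_zero]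
    simp
  have hun : 0 < ‖u‖ := norm_pos_iff.2 hu0
  by_contra hcon
  push Not at hcon
  set d := Real.sqrt κ * ‖u‖ with hd
  have hd2 : d ^ 2 = κ * ‖u‖ ^ 2 := by rw [hd, mul_pow, Real.sq_sqrt hκ0]
  have hd0 : 0 ≤ d := by positivity
  have hget : ∀ β ∈ borelSet Φ f, (¬ ∃ c : ℝ, β = c • α) →
      ∃ p ∈ W', (∀ b ∈ Y β, ρ b p = p) ∧ ‖u - p‖ ≤ d := by
    intro β hβ hβα
    obtain ⟨p, hp, hpf, hlt⟩ := hcon β hβ (by simpa using hβα)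
    refine ⟨p, hp, hpf, ?_⟩
    rw [← hd2] at hlt
    exact (pow_le_pow_iff_left₀ (norm_nonneg _) hd0 two_ne_zero).1 hlt.le
  have he := hdisp u d fun β hβ hβα => by
    obtain ⟨p, -, h⟩ := hget β hβ hβα
    exact ⟨p, h⟩
  obtain ⟨p, hp, hpf, hpd⟩ := hget δ hδ hpar
  have hest := key_estimate ρ (F := W' ⊓ fixSub ρ (Y δ : Set Γ))
    (hc'.inter (fixSub_closed ρ _)) x
    (fun q hq => key_orth hc' hi' x (Y δ) (fun y hy g => fixer_mono hle (hx y hy g))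
      (fun w hw h => hnf w hw (by rintro a ⟨y, hy, rfl⟩; exact h y hy)) q q hq hq)
    u p ⟨hp, hpf⟩ d (e * d) hpd he
  have h3 : (2 * d + e * d) ^ 2 = (2 + e) ^ 2 * (κ * ‖u‖ ^ 2) := by rw [← hd2]; ring
  rw [h3, hd2] at hest
  have hu2 : 0 < ‖u‖ ^ 2 := by positivity
  nlinarith

lemma exists_of_not_le {K L : Subgroup Γ} (h : ¬ K ≤ L) : ∃ x ∈ K, x ∉ L := by
  simpa [SetLike.le_def] using h

/-- Boundary case. -/
lemma good_boundary [CompleteSpace H] (hS : StrongSys Φ f Y) {ρ : Γ →* (H ≃ₗᵢ[ℂ] H)}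
    (hnoinv : ∀ w, (∀ γ ∈ borelCore Φ f, ∀ g ∈ Y γ, ρ g w = w) → w = 0)
    {W : Submodule ℂ H} (hWc : IsClosed (W : Set H)) (hW : InvSub ρ W) (hW0 : W ≠ ⊥) {α : E}
    (hα : α ∈ borelSet Φ f) (hb : α ∈ borelBoundary Φ f)
    (h1 : ∀ w ∈ W, (∀ a ∈ Y α, ρ a w = w) → w = 0) :
    ∃ W' : Submodule ℂ H, W' ≤ W ∧ IsClosed (W' : Set H) ∧ InvSub ρ W' ∧ W' ≠ ⊥ ∧
      GoodW Φ f Y ρ (kap Φ) W' := by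
  have hex : ∃ β, (β ∈ borelSet Φ f ∧ ¬ ∃ c : ℝ, β = c • α) ∧ ¬ Y β ≤ fixer ρ W := by
    by_contra hcon
    push Not at hcon
    apply hW0
    rw [Submodule.eq_bot_iff]
    intro w hw
    refine hnoinv w fun γ hγ g hg => hcon γ ⟨hγ.1, ?_⟩ hg w hw
    intro c hc
    exact hγ.2 (boundary_smul hb hγ.1 c hc)
  obtain ⟨β, ⟨⟨hβ, hβα⟩, hβn⟩, hmax⟩ := exists_max_f hS.root f _ (fun x hx => hx.1.1.1) hex
  have hN := fixer_normal hW
  have hcen : ∀ a ∈ (Y β : Set Γ), ∀ g : Γ, ⁅a, g⁆ ∈ fixer ρ W := by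
    intro a ha g
    refine comm_mem_of_gen (fixer ρ W) a _ hS.gen (borelSet Φ f) Y le_rfl (fun γ hγ y hy => ?_) g
    refine hS.comm_mem _ hβ hγ (fun δ hδ hlt _ hab => ?_) ha hy
    obtain ⟨a, b, ha, hb', hab⟩ := hab
    by_contra hδn
    exact hmax δ hlt ⟨⟨hδ, boundary_ideal hS.root hS.reg hb hβ hβα hγ hδ ha hb' hab⟩, hδn⟩
  obtain ⟨W', hle, hc', hi', hne', hnf⟩ := split_fix hWc hW (Y β : Set Γ) hcen
    (exists_of_not_le hβn)
  exact ⟨W', hle, hc', hi', hne', good_of_two hS.root hα hβ hβα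
    (fun w hw => h1 w (hle hw)) hnf⟩

/-- Core case. -/
lemma good_core [CompleteSpace H] (hS : StrongSys Φ f Y) {ρ : Γ →* (H ≃ₗᵢ[ℂ] H)}
    {W : Submodule ℂ H} (hWc : IsClosed (W : Set H)) (hW : InvSub ρ W) (hW0 : W ≠ ⊥) {α : E}
    (hα : α ∈ borelCore Φ f)
    (hcenα : ∀ a ∈ Y α, ∀ g : Γ, ⁅a, g⁆ ∈ fixer ρ W)
    (hbig : ∀ γ ∈ borelSet Φ f, f α < f γ → Y γ ≤ fixer ρ W)
    (h1 : ∀ w ∈ W, (∀ a ∈ Y α, ρ a w = w) → w = 0) :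
    ∃ W' : Submodule ℂ H, W' ≤ W ∧ IsClosed (W' : Set H) ∧ InvSub ρ W' ∧ W' ≠ ⊥ ∧
      GoodW Φ f Y ρ (kap Φ) W' := by
  classical
  have hαS := hα.1
  have hα0 : α ≠ 0 := fun h => hS.root.zero_notMem (h ▸ hαS.1)
  have hgen := hS.core_gen hα
  set R := {β ∈ borelSet Φ f | ¬ ∃ c : ℝ, β = c • α} with hR
  set Z0 := fixer ρ W with hZ0
  have hN0 : Z0.Normal := fixer_normal hW
  set Z1 := Subgroup.upperCentralSeriesStep Z0 with hZ1
  have hN1 : Z1.Normal := step_normal Z0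
  set Z2 := Subgroup.upperCentralSeriesStep Z1 with hZ2
  have hZ01 : Z0 ≤ Z1 := fun x hx y => by
    change ⁅x, y⁆ ∈ Z0
    rw [commutatorElement_def, mul_assoc, mul_assoc]
    exact Z0.mul_mem hx (by simpa [mul_assoc] using hN0.conj_mem _ (Z0.inv_mem hx) y)
  have hZ12 : Z1 ≤ Z2 := fun x hx y => hZ01 (hx y)
  by_cases hall : ∀ β ∈ R, Y β ≤ Z1
  · have hex : ∃ β ∈ R, ¬ Y β ≤ Z0 := by
      by_contra hcon
      push Not at hcon
      have htop : (⊤ : Subgroup Γ) ≤ Z0 := by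
        rw [← hgen]; exact iSup₂_le hcon
      apply hW0
      rw [Submodule.eq_bot_iff]
      intro w hw
      exact h1 w hw fun a _ => htop (Subgroup.mem_top a) w hw
    obtain ⟨β, hβ, hβn⟩ := hex
    obtain ⟨W', hle, hc', hi', hne', hnf⟩ := split_fix hWc hW (Y β : Set Γ)
      (fun a ha g => hall β hβ ha g) (exists_of_not_le hβn)
    exact ⟨W', hle, hc', hi', hne', good_of_two hS.root hαS hβ.1 hβ.2
      (fun w hw => h1 w (hle hw)) hnf⟩
  have hex : ∃ β, β ∈ R ∧ ¬ Y β ≤ Z1 := by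
    push Not at hall
    exact hall
  obtain ⟨β, ⟨hβ, hβn⟩, hmax⟩ := exists_max_f hS.root f _ (fun x hx => hx.1.1.1) hex
  -- a commutator not in the kernel
  have hfind : ∀ (K : Subgroup Γ) [K.Normal] (x : Γ),
      x ∉ Subgroup.upperCentralSeriesStep K → ∃ δ ∈ R, ∃ y ∈ Y δ, ⁅x, y⁆ ∉ K := by
    intro K _ x hx
    by_contra hcon
    push Not at hcon
    exact hx fun g => comm_mem_of_gen K x _ hgen R Y le_rfl hcon g
  have hfindγ : ∀ (K : Subgroup Γ) {β δ : E} (_ : β ∈ borelSet Φ f) (_ : δ ∈ borelSet Φ f)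
      {x y : Γ} (_ : x ∈ Y β) (_ : y ∈ Y δ), ⁅x, y⁆ ∉ K →
      ∃ γ ∈ borelSet Φ f, f β < f γ ∧ f δ < f γ ∧ ¬ Y γ ≤ K ∧
        ∃ a b : ℝ, 1 ≤ a ∧ 1 ≤ b ∧ γ = a • β + b • δ := by
    intro K β δ hβ hδ x y hx hy hn
    by_contra hcon
    push Not at hcon
    refine hn (hS.comm_mem K hβ hδ (fun γ hγ h2 h3 hab => ?_) hx hy)
    by_contra hc
    obtain ⟨a, b, ha, hb, hab⟩ := hab
    exact hcon γ hγ h2 h3 hc a b ha hb hab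
  have hself : ∀ {β γ : E}, β ∈ R → ∀ {a b : ℝ}, 1 ≤ a → 1 ≤ b → γ = a • β + b • β →
      ¬ ∃ c : ℝ, γ = c • α := by
    rintro β γ hβ a b ha hb hab ⟨c, hc⟩
    apply hβ.2
    have h0 : a + b ≠ 0 := by linarith
    refine ⟨(a + b)⁻¹ * c, ?_⟩
    rw [mul_smul, ← hc, hab, ← add_smul, smul_smul, inv_mul_cancel₀ h0, one_smul]
  have hneα : ∀ {β : E}, β ∈ R → β ≠ α := fun hβ h => hβ.2 ⟨1, by rw [one_smul, h]⟩
  by_cases hL : Y β ≤ Z2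
  · -- first case
    obtain ⟨x, hx, hxn⟩ := exists_of_not_le hβn
    obtain ⟨δ, hδ, y, hy, hxy⟩ := hfind Z0 x hxn
    obtain ⟨γ, hγ, hf1, hf2, hγn, a, b, ha, hb, hab⟩ := hfindγ Z0 hβ.1 hδ.1 hx hy hxy
    have hcard : 3 ≤ Φ.ncard / 2 := by
      by_cases hbd : β = δ
      · subst hbd
        have hγα : γ ≠ α := hneα ⟨hγ, hself hβ ha hb hab⟩
        have h3 := card_le_half hS.root f {β, γ, α} (by
          intro z hz
          simp only [Finset.mem_insert, Finset.mem_singleton] at hz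
          rcases hz with rfl | rfl | rfl
          · exact hβ.1
          · exact hγ
          · exact hαS)
        have hbg : β ≠ γ := fun h => by rw [h] at hf1; exact lt_irrefl _ hf1
        rwa [Finset.card_eq_three.2 ⟨β, γ, α, hbg, hneα hβ, hγα, rfl⟩] at h3
      · have h3 := card_le_half hS.root f {β, δ, γ} (by
          intro z hz
          simp only [Finset.mem_insert, Finset.mem_singleton] at hz
          rcases hz with rfl | rfl | rfl
          · exact hβ.1
          · exact hδ.1
          · exact hγ)
        have hbg : β ≠ γ := fun h => by rw [h] at hf1; exact lt_irrefl _ hf1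
        have hdg : δ ≠ γ := fun h => by rw [h] at hf2; exact lt_irrefl _ hf2
        rwa [Finset.card_eq_three.2 ⟨β, δ, γ, hbd, hbg, hdg, rfl⟩] at h3
    have hk := kap_le 3 (by norm_num) hcard
    norm_num at hk
    refine good_of_comm hWc hW hαS hδ.1 hδ.2 h1 x (fun y hy g => hL hx y g) ⟨y, hy, hxy⟩ 2 _
      (kap_nonneg Φ) (by linarith) ?_
    intro u d hd
    obtain ⟨p, hp, hpd⟩ := hd β hβ.1 hβ.2
    exact disp_le ρ x u p d (hp x hx) hpd
  · -- second case
    obtain ⟨x₁, hx₁, hx₁n⟩ := exists_of_not_le hL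
    obtain ⟨δ₁, hδ₁, y₁, hy₁, hxy₁⟩ := hfind Z1 x₁ hx₁n
    obtain ⟨γ, hγ, hf1, hf2, hγn, a, b, ha, hb, hab⟩ := hfindγ Z1 hβ.1 hδ₁.1 hx₁ hy₁ hxy₁
    have hγpar : ∃ c : ℝ, γ = c • α := by
      by_contra hc
      exact hmax γ hf1 ⟨⟨hγ, hc⟩, hγn⟩
    have hγα : γ ≠ α := by
      rintro rfl
      exact hγn hcenα
    have hfγα : f γ < f α := by
      by_contra hc
      rcases (not_lt.1 hc).lt_or_eq with h | h
      · exact hγn ((hbig γ hγ h).trans hZ01)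
      · exact hS.reg.2 γ hγ.1 α hαS.1 hγα h.symm
    have hcard : 4 ≤ Φ.ncard / 2 := by
      have hbd : β ≠ δ₁ := by
        rintro rfl
        exact hself hβ ha hb hab hγpar
      have h4 := card_le_half hS.root f {β, δ₁, γ, α} (by
        intro z hz
        simp only [Finset.mem_insert, Finset.mem_singleton] at hz
        rcases hz with rfl | rfl | rfl | rfl
        · exact hβ.1
        · exact hδ₁.1
        · exact hγ
        · exact hαS)
      have hbg : β ≠ γ := fun h => by rw [h] at hf1; exact lt_irrefl _ hf1
      have hdg : δ₁ ≠ γ := fun h => by rw [h] at hf2; exact lt_irrefl _ hf2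
      rwa [Finset.card_insert_of_notMem, Finset.card_eq_three.2
        ⟨δ₁, γ, α, hdg, hneα hδ₁, hγα, rfl⟩] at h4
      simp [hbd, hbg, hneα hβ]
    have hk := kap_le 4 (by norm_num) hcard
    norm_num at hk
    have hxZ2 : ⁅x₁, y₁⁆ ∈ Z2 := by
      refine hS.comm_mem Z2 hβ.1 hδ₁.1 (fun γ' hγ' h2 _ _ => ?_) hx₁ hy₁
      by_cases hp : ∃ c : ℝ, γ' = c • α
      · obtain ⟨c, hc⟩ := hp
        intro z hz g
        refine comm_mem_of_gen Z1 z _ hgen R Y le_rfl (fun δ hδ y hy => ?_) g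
        refine hS.comm_mem Z1 hγ' hδ.1 (fun η hη h3 _ hab' => ?_) hz hy
        by_contra hηn
        refine hmax η (h2.trans h3) ⟨⟨hη, ?_⟩, hηn⟩
        obtain ⟨a', b', ha', hb', hab'⟩ := hab'
        rintro ⟨c', hc'⟩
        apply hδ.2
        have hb0 : b' ≠ 0 := by linarith
        refine ⟨b'⁻¹ * (c' - a' * c), ?_⟩
        have h5 : b' • δ = (c' - a' * c) • α := by
          rw [sub_smul, mul_smul, ← hc, ← hc', hab']; abel
        rw [mul_smul, ← h5, smul_smul, inv_mul_cancel₀ hb0, one_smul]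
      · refine le_trans ?_ hZ12
        by_contra hn
        exact hmax γ' h2 ⟨⟨hγ', hp⟩, hn⟩
    obtain ⟨δ, hδ, y, hy, hxy⟩ := hfind Z0 _ hxy₁
    refine good_of_comm hWc hW hαS hδ.1 hδ.2 h1 ⁅x₁, y₁⁆ (fun y hy g => hxZ2 y g)
      ⟨y, hy, hxy⟩ 8 _ (kap_nonneg Φ) (by linarith) ?_
    intro u d hd
    obtain ⟨p, hp, hpd⟩ := hd β hβ.1 hβ.2
    obtain ⟨q, hq, hqd⟩ := hd δ₁ hδ₁.1 hδ₁.2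
    have e1 := disp_le ρ x₁ u p d (hp x₁ hx₁) hpd
    have e2 := disp_le ρ y₁ u q d (hq y₁ hy₁) hqd
    have e3 := disp_comm ρ x₁ y₁ u
    linarith

/-- Every nonzero invariant closed subspace contains a good one. -/
lemma exists_good [CompleteSpace H] (hS : StrongSys Φ f Y) {ρ : Γ →* (H ≃ₗᵢ[ℂ] H)}
    (hnoinv : ∀ w, (∀ γ ∈ borelCore Φ f, ∀ g ∈ Y γ, ρ g w = w) → w = 0)
    {W : Submodule ℂ H} (hWc : IsClosed (W : Set H)) (hW : InvSub ρ W) (hW0 : W ≠ ⊥) :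
    ∃ W' : Submodule ℂ H, W' ≤ W ∧ IsClosed (W' : Set H) ∧ InvSub ρ W' ∧ W' ≠ ⊥ ∧
      GoodW Φ f Y ρ (kap Φ) W' := by
  have hex : ∃ β, β ∈ borelSet Φ f ∧ ¬ Y β ≤ fixer ρ W := by
    by_contra hcon
    push Not at hcon
    apply hW0
    rw [Submodule.eq_bot_iff]
    intro w hw
    exact hnoinv w fun γ hγ g hg => hcon γ hγ.1 hg w hw
  obtain ⟨α, ⟨hα, hαn⟩, hmax⟩ := exists_max_f hS.root f _ (fun x hx => hx.1.1) hex
  have hN := fixer_normal hW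
  have hbig : ∀ γ ∈ borelSet Φ f, f α < f γ → Y γ ≤ fixer ρ W := by
    intro γ hγ hlt
    by_contra hn
    exact hmax γ hlt ⟨hγ, hn⟩
  have hcen : ∀ a ∈ Y α, ∀ g : Γ, ⁅a, g⁆ ∈ fixer ρ W := by
    intro a ha g
    refine comm_mem_of_gen (fixer ρ W) a _ hS.gen (borelSet Φ f) Y le_rfl (fun γ hγ y hy => ?_) g
    exact hS.comm_mem _ hα hγ (fun δ hδ hlt _ _ => hbig δ hδ hlt) ha hy
  obtain ⟨W', hle, hc', hi', hne', hnf⟩ := split_fix hWc hW (Y α : Set Γ) hcen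
    (exists_of_not_le hαn)
  by_cases hb : α ∈ borelBoundary Φ f
  · obtain ⟨W'', h1, h2⟩ := good_boundary hS hnoinv hc' hi' hne' hα hb hnf
    exact ⟨W'', h1.trans hle, h2⟩
  · obtain ⟨W'', h1, h2⟩ := good_core hS hc' hi' hne' ⟨hα, hb⟩
      (fun a ha g => fixer_mono hle (hcen a ha g))
      (fun γ hγ hlt => (hbig γ hγ hlt).trans (fixer_mono hle)) hnf
    exact ⟨W'', h1.trans hle, h2⟩

end LocalPart

/-! ### From good subrepresentations to the inequality -/

section FinalPart

variable {E : Type*} [AddCommGroup E] [Module ℝ E]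

/-- The opposite of a set. -/
def negSet (B : Set E) : Set E := {x | -x ∈ B}

lemma negSet_negSet (B : Set E) : negSet (negSet B) = B := by
  ext x; simp [negSet]

lemma mem_negSet {B : Set E} {x : E} : x ∈ negSet B ↔ -x ∈ B := Iff.rfl

lemma negSet_borel {Φ : Set E} (hΦ : IsRootSystem Φ) {B : Set E} (hB : IsBorelSet Φ B) :
    IsBorelSet Φ (negSet B) := by
  obtain ⟨g, hg, rfl⟩ := hB
  refine ⟨-g, ⟨fun α hα => by simpa using hg.1 α hα, fun α hα β hβ hab => by
    simpa using hg.2 α hα β hβ hab⟩, ?_⟩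
  ext x
  constructor
  · rintro ⟨h1, h2⟩
    refine ⟨by simpa using hΦ.neg_mem _ h1, by simpa using h2⟩
  · rintro ⟨h1, h2⟩
    exact ⟨hΦ.neg_mem _ h1, by simpa using h2⟩

lemma borel_neg_iff {Φ : Set E} (hΦ : IsRootSystem Φ) {B : Set E} (hB : IsBorelSet Φ B) {x : E}
    (hx : x ∈ Φ) : -x ∈ B ↔ x ∉ B := by
  obtain ⟨g, hg, rfl⟩ := hB
  have h0 := hg.1 x hx
  constructor
  · rintro ⟨-, h2⟩ ⟨-, h3⟩
    rw [map_neg] at h2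
    linarith
  · intro h
    refine ⟨hΦ.neg_mem x hx, ?_⟩
    rw [map_neg]
    have : ¬ 0 < g x := fun h' => h ⟨hx, h'⟩
    rcases lt_or_gt_of_ne h0 with h1 | h1
    · linarith
    · exact absurd h1 this

lemma borel_sub {Φ : Set E} {B : Set E} (hB : IsBorelSet Φ B) : B ⊆ Φ := by
  obtain ⟨g, hg, rfl⟩ := hB
  exact fun x hx => hx.1

lemma neg_mem_family {Φ : Set E} (hΦ : IsRootSystem Φ) {f : E →ₗ[ℝ] ℝ} (hf : IsRegularFunc Φ f)
    {𝔅 : Finset (Set E)}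
    (h𝔅 : ∀ B : Set E,
      B ∈ 𝔅 ↔ IsBorelSet Φ B ∧ B ≠ borelSet Φ f ∧ (B ∩ borelSet Φ f).Nonempty)
    {B : Set E} (hB : B ∈ 𝔅) : negSet B ∈ 𝔅 := by
  have hfB : IsBorelSet Φ (borelSet Φ f) := ⟨f, hf, rfl⟩
  obtain ⟨h1, h2, x, hxB, hxf⟩ := (h𝔅 B).1 hB
  refine (h𝔅 _).2 ⟨negSet_borel hΦ h1, ?_, ?_⟩
  · intro heq
    rw [← heq, mem_negSet, borel_neg_iff hΦ h1 (borel_sub h1 hxB)] at hxf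
    exact hxf hxB
  · by_contra hcon
    rw [Set.not_nonempty_iff_eq_empty] at hcon
    have hsub : ∀ y ∈ borelSet Φ f, y ∈ B := by
      intro y hy
      by_contra hyB
      have : y ∈ negSet B ∩ borelSet Φ f := ⟨(borel_neg_iff hΦ h1 hy.1).2 hyB, hy⟩
      rw [hcon] at this
      exact this
    apply h2
    refine Set.Subset.antisymm (fun y hy => ?_) hsub
    by_contra hyf
    have hyΦ := borel_sub h1 hy
    have := hsub _ ((borel_neg_iff hΦ hfB hyΦ).2 hyf)
    exact (borel_neg_iff hΦ h1 hyΦ).1 this hy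

lemma family_card {Φ : Set E} (hΦ : IsRootSystem Φ) {f : E →ₗ[ℝ] ℝ} (hf : IsRegularFunc Φ f)
    {𝔅 : Finset (Set E)}
    (h𝔅 : ∀ B : Set E,
      B ∈ 𝔅 ↔ IsBorelSet Φ B ∧ B ≠ borelSet Φ f ∧ (B ∩ borelSet Φ f).Nonempty)
    {N : ℕ} (hN : {B : Set E | IsBorelSet Φ B}.ncard = N) {α : E} (hα : α ∈ borelSet Φ f) :
    𝔅.card + 2 ≤ N := by
  classical
  have hfB : IsBorelSet Φ (borelSet Φ f) := ⟨f, hf, rfl⟩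
  have hdisj : ∀ x ∈ borelSet Φ f, x ∉ negSet (borelSet Φ f) := fun x hx h =>
    (borel_neg_iff hΦ hfB hx.1).1 h hx
  have hfin : {B : Set E | IsBorelSet Φ B}.Finite :=
    hΦ.finite.finite_subsets.subset fun B hB => borel_sub hB
  have h1 : negSet (borelSet Φ f) ∉ 𝔅 := by
    intro h
    obtain ⟨-, -, x, hx1, hx2⟩ := (h𝔅 _).1 h
    exact hdisj x hx2 hx1
  have h2 : borelSet Φ f ∉ insert (negSet (borelSet Φ f)) 𝔅 := by
    intro h
    rcases Finset.mem_insert.1 h with h | h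
    · exact hdisj α hα (h ▸ hα)
    · exact ((h𝔅 _).1 h).2.1 rfl
  have h3 : ((insert (borelSet Φ f) (insert (negSet (borelSet Φ f)) 𝔅) : Finset (Set E)) :
      Set (Set E)) ⊆ {B : Set E | IsBorelSet Φ B} := by
    intro B hB
    rcases Finset.mem_insert.1 (Finset.mem_coe.1 hB) with rfl | hB
    · exact hfB
    rcases Finset.mem_insert.1 hB with rfl | hB
    · exact negSet_borel hΦ hfB
    · exact ((h𝔅 _).1 hB).1
  have h4 := Set.ncard_le_ncard h3 hfin
  rw [Set.ncard_coe_finset, Finset.card_insert_of_notMem h2, Finset.card_insert_of_notMem h1,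
    hN] at h4
  omega

open Classical in
lemma family_half {Φ : Set E} (hΦ : IsRootSystem Φ) {f : E →ₗ[ℝ] ℝ} (hf : IsRegularFunc Φ f)
    {𝔅 : Finset (Set E)}
    (h𝔅 : ∀ B : Set E,
      B ∈ 𝔅 ↔ IsBorelSet Φ B ∧ B ≠ borelSet Φ f ∧ (B ∩ borelSet Φ f).Nonempty)
    {α : E} (hα : α ∈ borelSet Φ f) :
    𝔅.card = 2 * (𝔅.filter fun B => α ∉ B).card := by
  have h1 := Finset.card_filter_add_card_filter_not (s := 𝔅) (fun B => α ∉ B)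
  have h2 : (𝔅.filter fun B => α ∉ B).card = (𝔅.filter fun B => ¬ α ∉ B).card := by
    refine Finset.card_nbij' negSet negSet ?_ ?_ (fun B _ => negSet_negSet B)
      (fun B _ => negSet_negSet B)
    · intro B hB
      have hB := Finset.mem_filter.1 hB
      refine Finset.mem_filter.2 ⟨neg_mem_family hΦ hf h𝔅 hB.1, not_not.2 ?_⟩
      exact (borel_neg_iff hΦ ((h𝔅 _).1 hB.1).1 hα.1).2 hB.2
    · intro B hB
      have hB := Finset.mem_filter.1 hB
      refine Finset.mem_filter.2 ⟨neg_mem_family hΦ hf h𝔅 hB.1, ?_⟩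
      intro h
      exact (borel_neg_iff hΦ ((h𝔅 _).1 hB.1).1 hα.1).1 h (not_not.1 hB.2)
  omega

lemma mean_identity {H : Type*} [NormedAddCommGroup H] [InnerProductSpace ℂ H] {ι : Type*}
    (T : Finset ι) (v : ι → H) (u : H) (hu : ∑ i ∈ T, v i = (T.card : ℂ) • u) :
    ∑ i ∈ T, ‖u - v i‖ ^ 2 = ∑ i ∈ T, ‖v i‖ ^ 2 - T.card * ‖u‖ ^ 2 := by
  have h1 : ∀ i ∈ T, ‖u - v i‖ ^ 2 = ‖u‖ ^ 2 - 2 * RCLike.re (inner ℂ u (v i)) + ‖v i‖ ^ 2 :=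
    fun i _ => norm_sub_sq (𝕜 := ℂ) u (v i)
  rw [Finset.sum_congr rfl h1, Finset.sum_add_distrib, Finset.sum_sub_distrib, ← Finset.mul_sum,
    ← map_sum, ← inner_sum, hu, inner_smul_right, inner_self_eq_norm_sq_to_K]
  have : (RCLike.re ((T.card : ℂ) * ((‖u‖ : ℂ)) ^ 2) : ℝ) = T.card * ‖u‖ ^ 2 := by
    have : ((T.card : ℂ) * ((‖u‖ : ℂ)) ^ 2) = (((T.card : ℝ) * ‖u‖ ^ 2 : ℝ) : ℂ) := by
      push_cast; rfl
    rw [this]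
    exact Complex.ofReal_re _
  simp only [Finset.sum_const, nsmul_eq_mul]
  erw [this]
  ring

lemma final_arith {K M q κ ε U V : ℝ} (hK : 1 ≤ K) (hq : 4 ≤ q) (hM : 2 * K ≤ M)
    (hκ : κ = 1 / (q - 1)) (hε : ε = 2 / (M * q)) (hV : 0 ≤ V)
    (h : κ * U ≤ V - K * U) : K ^ 2 * U ≤ K * (1 - ε) * V := by
  have h1 : K * ε ≤ 1 / q := by
    rw [hε]
    have hM0 : 0 < M := by linarith
    rw [← mul_div_assoc, div_le_div_iff₀ (by positivity) (by positivity)]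
    nlinarith
  have h2 : (K - 1 / q) * V ≤ K * (1 - ε) * V := by nlinarith
  refine le_trans ?_ h2
  have hq1 : 0 < q - 1 := by linarith
  have h3 : (κ + K) * U ≤ V := by linarith
  have hκp : 0 < κ + K := by rw [hκ]; positivity
  have h5 : K ^ 2 ≤ (K - 1 / q) * (κ + K) := by
    rw [hκ]
    have : (K - 1 / q) * (1 / (q - 1) + K) - K ^ 2 = (K - 1) / (q * (q - 1)) := by
      field_simp; ring
    have : 0 ≤ (K - 1) / (q * (q - 1)) := div_nonneg (by linarith) (by positivity)
    linarith
  have h6 : 1 / q ≤ 1 := by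
    rw [div_le_one (by linarith)]; linarith
  have h7 : 0 ≤ K - 1 / q := by linarith
  by_cases hU : 0 ≤ U
  · calc K ^ 2 * U ≤ (K - 1 / q) * (κ + K) * U := by gcongr
      _ = (K - 1 / q) * ((κ + K) * U) := by ring
      _ ≤ _ := by gcongr
  · have : K ^ 2 * U ≤ 0 := by nlinarith [sq_nonneg K]
    exact this.trans (mul_nonneg h7 hV)

lemma good_ineq {Φ : Set E} (hΦ : IsRootSystem Φ) {f : E →ₗ[ℝ] ℝ} (hf : IsRegularFunc Φ f)
    {𝔅 : Finset (Set E)}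
    (h𝔅 : ∀ B : Set E,
      B ∈ 𝔅 ↔ IsBorelSet Φ B ∧ B ≠ borelSet Φ f ∧ (B ∩ borelSet Φ f).Nonempty)
    {N : ℕ} (hN : {B : Set E | IsBorelSet Φ B}.ncard = N)
    {ε : ℝ} (hε : ε = 8 / (((N : ℝ) - 2) * 4 ^ (Φ.ncard / 2)))
    {Γ : Type*} [Group Γ] {Y : E → Subgroup Γ}
    {H : Type*} [NormedAddCommGroup H] [InnerProductSpace ℂ H] {ρ : Γ →* (H ≃ₗᵢ[ℂ] H)}
    (A : Set E → Set Γ) (hA : ∀ B ∈ 𝔅, ∀ α ∈ borelSet Φ f ∩ B, (Y α : Set Γ) ⊆ A B)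
    {W : Submodule ℂ H} (hgood : GoodW Φ f Y ρ (kap Φ) W) :
    IneqOn ρ 𝔅 A ((𝔅.card : ℝ) / 2 * (1 - ε)) W := by
  classical
  obtain ⟨α, hα, hαf, hu⟩ := hgood
  intro v hv
  set T := 𝔅.filter fun B => α ∉ B with hT
  have hzero : ∀ B ∈ 𝔅, B ∉ T → v B = 0 := by
    intro B hB hBT
    have hαB : α ∈ B := by
      by_contra h
      exact hBT (Finset.mem_filter.2 ⟨hB, h⟩)
    exact hαf _ (hv B hB).1 fun a ha => (hv B hB).2 a (hA B hB α ⟨hα, hαB⟩ ha)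
  have hs1 : ∑ B ∈ 𝔅, v B = ∑ B ∈ T, v B :=
    (Finset.sum_subset (Finset.filter_subset _ _) hzero).symm
  have hs2 : ∑ B ∈ 𝔅, ‖v B‖ ^ 2 = ∑ B ∈ T, ‖v B‖ ^ 2 :=
    (Finset.sum_subset (Finset.filter_subset _ _) fun B h1 h2 => by
      rw [hzero B h1 h2]; simp).symm
  have hcard : 𝔅.card = 2 * T.card := family_half hΦ hf h𝔅 hα
  have hcardN := family_card hΦ hf h𝔅 hN hα
  set u : H := ((T.card : ℂ)⁻¹) • ∑ B ∈ T, v B with hudef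
  have huW : u ∈ W := W.smul_mem _ (W.sum_mem fun B hB => (hv B (Finset.mem_filter.1 hB).1).1)
  obtain ⟨β, hβ, hβα, hp⟩ := hu u huW
  -- a Borel set separating
  have hα0 : α ≠ 0 := fun h => hΦ.zero_notMem (h ▸ hα.1)
  obtain ⟨g₀, hg1, hg2⟩ := exists_sep hα0 hβα
  obtain ⟨g, hg, hsign⟩ := exists_regular hΦ.finite hf g₀
  have hgα := (hsign α hα.1).2 (by rw [hg1]; norm_num)
  have hgβ := (hsign β hβ.1).1 (by rw [hg2]; norm_num)
  have hαB : α ∉ borelSet Φ g := fun h => absurd h.2 (not_lt.2 hgα.le)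
  have hβB : β ∈ borelSet Φ g := ⟨hβ.1, hgβ⟩
  have hB0 : borelSet Φ g ∈ 𝔅 := (h𝔅 _).2 ⟨⟨g, hg, rfl⟩, fun h => hαB (h ▸ hα), β, hβB, hβ⟩
  have hB0T : borelSet Φ g ∈ T := Finset.mem_filter.2 ⟨hB0, hαB⟩
  have hTpos : 0 < T.card := Finset.card_pos.2 ⟨_, hB0T⟩
  have hTne : (T.card : ℂ) ≠ 0 := by exact_mod_cast hTpos.ne'
  have hsum : ∑ B ∈ T, v B = (T.card : ℂ) • u := by
    rw [hudef, smul_smul, mul_inv_cancel₀ hTne, one_smul]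
  have hmean := mean_identity T v u hsum
  have hp0 := hp (v (borelSet Φ g)) (hv _ hB0).1
    fun b hb => (hv _ hB0).2 b (hA _ hB0 β ⟨hβ, hβB⟩ hb)
  have hle : ‖u - v (borelSet Φ g)‖ ^ 2 ≤ ∑ B ∈ T, ‖u - v B‖ ^ 2 :=
    Finset.single_le_sum (f := fun B => ‖u - v B‖ ^ 2) (fun B _ => sq_nonneg _) hB0T
  have hm : 2 ≤ Φ.ncard / 2 := by
    have hne : α ≠ β := fun h => hβα ⟨1, by rw [one_smul, h]⟩
    have hc := card_le_half hΦ f {α, β} (by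
      intro x hx
      rcases Finset.mem_insert.1 hx with rfl | hx
      · exact hα
      · rw [Finset.mem_singleton.1 hx]; exact hβ)
    rwa [Finset.card_pair hne] at hc
  have hq : (4 : ℝ) ≤ 4 ^ (Φ.ncard / 2 - 1) := by
    calc (4 : ℝ) = 4 ^ 1 := by norm_num
      _ ≤ _ := pow_le_pow_right₀ (by norm_num) (by omega)
  have hq' : (4 : ℝ) ^ (Φ.ncard / 2) = 4 * 4 ^ (Φ.ncard / 2 - 1) := by
    rw [← pow_succ']; congr 1; omega
  have hNr : (𝔅.card : ℝ) + 2 ≤ N := by exact_mod_cast hcardN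
  have hcr : (𝔅.card : ℝ) = 2 * T.card := by exact_mod_cast hcard
  have hTr : (1 : ℝ) ≤ T.card := by exact_mod_cast hTpos
  rw [hs1, hs2, hsum, norm_smul, mul_pow, hcr]
  have hnc : ‖(T.card : ℂ)‖ = T.card := by simp
  rw [hnc, mul_div_cancel_left₀ _ (two_ne_zero)]
  refine final_arith (M := (N : ℝ) - 2) (q := 4 ^ (Φ.ncard / 2 - 1)) (κ := kap Φ) hTr hq
    (by linarith) rfl ?_ (Finset.sum_nonneg fun B _ => sq_nonneg _) ?_
  · rw [hε, hq']
    have : (N : ℝ) - 2 ≠ 0 := by linarith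
    field_simp
    norm_num
  · rw [← hmean]
    exact hp0.trans hle

/-- Transport of the strong grading to the subgroup `G_f`. -/
lemma strongSys_of {Φ : Set E} (hΦ : IsRootSystem Φ) {G : Type*} [Group G] (X : E → Subgroup G)
    (hgrad : GradingCond Φ X) (hstrong : IsStrong Φ X) (f : E →ₗ[ℝ] ℝ) (hf : IsRegularFunc Φ f)
    (Gf : Subgroup G) (hGf : Gf = ⨆ α ∈ borelSet Φ f, X α) :
    StrongSys Φ f fun α => (X α).subgroupOf Gf := by
  have hle : ∀ α ∈ borelSet Φ f, X α ≤ Gf := by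
    intro α hα
    rw [hGf]
    exact le_iSup₂_of_le (f := fun (β : E) (_ : β ∈ borelSet Φ f) => X β) α hα le_rfl
  have hmap : ∀ α ∈ borelSet Φ f, ((X α).subgroupOf Gf).map Gf.subtype = X α := by
    intro α hα
    rw [Subgroup.subgroupOf_map_subtype]
    exact inf_eq_left.2 (hle α hα)
  have hsup : ∀ R : Set E, R ⊆ borelSet Φ f →
      (⨆ α ∈ R, (X α).subgroupOf Gf).map Gf.subtype = ⨆ α ∈ R, X α := by
    intro R hR
    rw [Subgroup.map_iSup]
    refine iSup_congr fun α => ?_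
    rw [Subgroup.map_iSup]
    exact iSup_congr fun hα => hmap α (hR hα)
  have hinj : Function.Injective Gf.subtype := Gf.subtype_injective
  refine ⟨hΦ, hf, ?_, ?_, ?_⟩
  · apply Subgroup.map_injective hinj
    rw [hsup _ subset_rfl, ← hGf, ← MonoidHom.range_eq_map, Subgroup.range_subtype]
  · intro α hα β hβ
    rw [← Subgroup.map_le_map_iff_of_injective hinj, hsup _ fun γ hγ => hγ.1,
      Subgroup.map_commutator, hmap α hα, hmap β hβ]
    refine (hgrad α hα.1 β hβ.1 ?_).trans ?_
    · rintro ⟨c, hc, h⟩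
      have h1 : 0 < f α := hα.2
      have h2 : 0 < f β := hβ.2
      rw [h, map_smul, smul_eq_mul] at h1
      nlinarith
    · refine iSup₂_le fun γ hγ => ?_
      obtain ⟨h1, a, b, ha, hb, hab⟩ := hγ
      refine le_iSup₂_of_le (f := fun (γ : E) (_ : γ ∈ {γ ∈ borelSet Φ f |
        ∃ a b : ℝ, 1 ≤ a ∧ 1 ≤ b ∧ γ = a • α + b • β}) => X γ) γ
        ⟨⟨h1, ?_⟩, a, b, ha, hb, hab⟩ le_rfl
      have := (f_big hα hβ ha hb hab).1
      exact lt_trans hα.2 this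
  · intro γ hγ
    rw [← Subgroup.map_le_map_iff_of_injective hinj, hsup _ fun β hβ => hβ.1, hmap γ hγ.1]
    exact hstrong f hf γ hγ

end FinalPart

/-- Theorem 5.10: let `Φ` have exactly `N` Borel subsets and let `{X_α}` be a
strong `Φ`-grading of `G`.  With `f ∈ F(Φ)`, `G_f = ⟨X_α : α ∈ Φ_f⟩`,
`CG_f = ⟨X_α : α ∈ C_f⟩`, `𝔅 = E_f` the collection of Borel sets `B ≠ Φ_f`
meeting `Φ_f`, `G_{f,B} = ⟨X_α : α ∈ Φ_f ∩ B⟩`, and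
`ε_Φ = 8/((N-2)·4^{|Φ|/2})`: for every unitary representation `H` of `G_f`
without nonzero `CG_f`-invariant vectors and vectors `v B ∈ H^{G_{f,B}}`, one has
`‖Σ v_B‖² ≤ (|E_f|/2)(1 - ε_Φ)·Σ ‖v_B‖²`, i.e. the codistance between the
subspaces `H^{G_{f,B}}` is at most `(1 - ε_Φ)/2`. -/
theorem statement10 {E : Type*} [AddCommGroup E] [Module ℝ E] [FiniteDimensional ℝ E]
    (Φ : Set E) (hΦ : IsRootSystem Φ)
    (N : ℕ) (hN : {B : Set E | IsBorelSet Φ B}.ncard = N)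
    {G : Type*} [Group G] (X : E → Subgroup G)
    (hgrad : IsGrading Φ X) (hstrong : IsStrong Φ X)
    (f : E →ₗ[ℝ] ℝ) (hf : IsRegularFunc Φ f)
    (Gf : Subgroup G) (hGf : Gf = ⨆ α ∈ borelSet Φ f, X α)
    (CGf : Subgroup G) (hCGf : CGf = ⨆ α ∈ borelCore Φ f, X α)
    (𝔅 : Finset (Set E))
    (h𝔅 : ∀ B : Set E,
      B ∈ 𝔅 ↔ IsBorelSet Φ B ∧ B ≠ borelSet Φ f ∧ (B ∩ borelSet Φ f).Nonempty)
    (εΦ : ℝ) (hεΦ : εΦ = 8 / (((N : ℝ) - 2) * 4 ^ (Φ.ncard / 2)))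
    (H : Type*) [NormedAddCommGroup H] [InnerProductSpace ℂ H] [CompleteSpace H]
    (ρ : Gf →* (H ≃ₗᵢ[ℂ] H))
    (hnoinv : ∀ w : H, (∀ g : Gf, (g : G) ∈ CGf → ρ g w = w) → w = 0)
    (v : Set E → H)
    (hv : ∀ B ∈ 𝔅, ∀ g : Gf,
      (g : G) ∈ (⨆ α ∈ borelSet Φ f ∩ B, X α : Subgroup G) → ρ g (v B) = v B) :
    ‖∑ B ∈ 𝔅, v B‖ ^ 2 ≤ ((𝔅.card : ℝ) / 2) * (1 - εΦ) * ∑ B ∈ 𝔅, ‖v B‖ ^ 2 := by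
  have hS := strongSys_of hΦ X hgrad.1 hstrong f hf Gf hGf
  have hnoinv2 : ∀ w : H, (∀ γ ∈ borelCore Φ f, ∀ g ∈ (X γ).subgroupOf Gf, ρ g w = w) →
      w = 0 := by
    intro w hw
    apply hnoinv
    have h1 : (⨆ γ ∈ borelCore Φ f, X γ) ≤ (fixer ρ (ℂ ∙ w)).map Gf.subtype := by
      refine iSup₂_le fun γ hγ g hg => ?_
      have hgG : g ∈ Gf := by
        rw [hGf]
        exact (le_iSup₂_of_le (f := fun (β : E) (_ : β ∈ borelSet Φ f) => X β) γ hγ.1 le_rfl) hg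
      refine ⟨⟨g, hgG⟩, ?_, rfl⟩
      intro z hz
      obtain ⟨c, rfl⟩ := Submodule.mem_span_singleton.1 hz
      rw [map_smul, hw γ hγ ⟨g, hgG⟩ hg]
    intro g hg
    rw [hCGf] at hg
    obtain ⟨g', hg', heq⟩ := h1 hg
    have : g' = g := Subtype.ext heq
    rw [← this]
    exact hg' w (Submodule.mem_span_singleton_self w)
  have hA : ∀ B ∈ 𝔅, ∀ α ∈ borelSet Φ f ∩ B, (((X α).subgroupOf Gf : Subgroup Gf) : Set Gf) ⊆
      {g : Gf | (g : G) ∈ (⨆ α ∈ borelSet Φ f ∩ B, X α : Subgroup G)} := by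
    intro B _ α hα g hg
    exact (le_iSup₂_of_le (f := fun (β : E) (_ : β ∈ borelSet Φ f ∩ B) => X β) α hα le_rfl)
      (Subgroup.mem_subgroupOf.1 hg)
  refine local_global ρ 𝔅 (fun B => {g : Gf | (g : G) ∈
    (⨆ α ∈ borelSet Φ f ∩ B, X α : Subgroup G)}) _ ?_ v fun B hB =>
      ⟨Submodule.mem_top, fun g hg => hv B hB g hg⟩
  intro W hWc hWi hW0
  obtain ⟨W', hle, hc, hi, hne, hg⟩ := exists_good hS hnoinv2 hWc hWi hW0
  exact ⟨W', hle, hc, hi, hne, good_ineq hΦ hf h𝔅 hN hεΦ _ hA hg⟩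
end

section
/- Let Φ be a root system in V = span_ℝ(Φ), let η : V → V′ be a surjective linear map onto a nonzero real vector space, and let Φ′ = η(Φ) \ {0}. Let {X_α}_{α∈Φ} be a family of subgroups of a group satisfying the grading condition for Φ, and for α′ ∈ Φ′ set Y_{α′} = ⟨X_α : α ∈ Φ, η(α) = α′⟩. Then Φ′ is a root system in V′, and the family {Y_{α′}}_{α′∈Φ′} satisfies the grading condition for Φ′: for all α′, β′ ∈ Φ′ with α′ ∉ ℝ_{<0}·β′, the commutator [Y_{α′}, Y_{β′}] is contained in the subgroup generated by {Y_{γ′} : γ′ ∈ Φ′ and γ′ = aα′ + bβ′ for some real numbers a, b ≥ 1}. -/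
open scoped commutatorElement in
/-- One-sided step: commutators with a join, when the pieces normalize the target. -/
theorem aux_comm_iSup_le {G : Type*} [Group G] {ι : Type*} (s : Set ι) (A : ι → Subgroup G)
    (B H : Subgroup G) (hN : ∀ i ∈ s, A i ≤ Subgroup.normalizer (H : Set G))
    (hA : ∀ i ∈ s, ⁅A i, B⁆ ≤ H) : ⁅⨆ i ∈ s, A i, B⁆ ≤ H := by
  let K : Subgroup G :=
    { carrier := {x | x ∈ Subgroup.normalizer (H : Set G) ∧ ∀ y ∈ B, ⁅x, y⁆ ∈ H}
      one_mem' := ⟨one_mem _, fun y _ => by simp [one_mem]⟩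
      mul_mem' := by
        rintro a b ⟨ha, ha'⟩ ⟨hb, hb'⟩
        refine ⟨mul_mem ha hb, fun y hy => ?_⟩
        have h1 := (Subgroup.mem_normalizer_iff.1 ha _).1 (hb' y hy)
        have h2 := mul_mem h1 (ha' y hy)
        have e : ⁅a * b, y⁆ = a * ⁅b, y⁆ * a⁻¹ * ⁅a, y⁆ := by
          simp only [commutatorElement_def]; group
        rw [e]; exact h2
      inv_mem' := by
        rintro a ⟨ha, ha'⟩
        refine ⟨inv_mem ha, fun y hy => ?_⟩
        have h1 := (Subgroup.mem_normalizer_iff.1 (inv_mem ha) _).1 (inv_mem (ha' y hy))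
        have e : ⁅a⁻¹, y⁆ = a⁻¹ * ⁅a, y⁆⁻¹ * a⁻¹⁻¹ := by
          simp only [commutatorElement_def]; group
        rw [e]; exact h1 }
  have hK : (⨆ i ∈ s, A i) ≤ K := by
    refine iSup₂_le fun i hi x hx => ⟨hN i hi hx, fun y hy => ?_⟩
    exact hA i hi (Subgroup.commutator_mem_commutator hx hy)
  rw [Subgroup.commutator_le]
  intro x hx y hy
  exact (hK hx).2 y hy

open scoped commutatorElement in
/-- A subgroup whose commutators with the generators of `⨆ B j` stay inside normalizes it. -/
theorem aux_le_normalizer {G : Type*} [Group G] {ι : Type*} (s : Set ι) (B : ι → Subgroup G)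
    (A : Subgroup G) (h : ∀ j ∈ s, ⁅A, B j⁆ ≤ ⨆ j ∈ s, B j) :
    A ≤ Subgroup.normalizer ((⨆ j ∈ s, B j : Subgroup G) : Set G) := by
  set H : Subgroup G := ⨆ j ∈ s, B j with hH
  have key : ∀ x ∈ A, ∀ g ∈ H, x * g * x⁻¹ ∈ H := by
    intro x hx
    have : H ≤ H.comap (MulAut.conj x).toMonoidHom := by
      conv_lhs => rw [hH]
      refine iSup₂_le fun j hj g hg => ?_
      have h1 := h j hj (Subgroup.commutator_mem_commutator hx hg)
      have h2 : g ∈ H := (le_iSup₂_of_le (f := fun j (_ : j ∈ s) => B j) j hj le_rfl) hg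
      have h3 := mul_mem h1 h2
      have e : ⁅x, g⁆ * g = x * g * x⁻¹ := by
        simp only [commutatorElement_def]; group
      rw [e] at h3
      simpa using h3
    intro g hg
    simpa using this hg
  intro x hx
  rw [Subgroup.mem_normalizer_iff]
  intro g
  refine ⟨key x hx g, fun hg => ?_⟩
  have := key x⁻¹ (inv_mem hx) _ hg
  simpa [mul_assoc] using this

/-- Lemma 6.2: if `η : V → V'` is a surjective linear map (a reduction) and
`{X_α}_{α∈Φ}` satisfies the grading condition, then `Φ' = η(Φ) \ {0}` is a root
system in `V'` and the coarsened family `Y_{α'} = ⟨X_α : η(α) = α'⟩` satisfies the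
grading condition for `Φ'`. -/
theorem statement11 {E V' : Type*} [AddCommGroup E] [Module ℝ E] [FiniteDimensional ℝ E]
    [AddCommGroup V'] [Module ℝ V'] [Nontrivial V']
    (Φ : Set E) (hΦ : IsRootSystem Φ)
    (η : E →ₗ[ℝ] V') (hη : Function.Surjective η)
    {G : Type*} [Group G] (X : E → Subgroup G) (hX : GradingCond Φ X)
    (Y : V' → Subgroup G) (hY : ∀ α' : V', Y α' = ⨆ α ∈ {α ∈ Φ | η α = α'}, X α) :
    IsRootSystem (η '' Φ \ {0}) ∧ GradingCond (η '' Φ \ {0}) Y := by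
  refine ⟨⟨(hΦ.finite.image η).subset Set.sdiff_subset, ?_, fun h => h.2 rfl, ?_⟩, ?_⟩
  · rw [Submodule.span_sdiff_singleton_zero, Submodule.span_image, hΦ.spans, Submodule.map_top,
      LinearMap.range_eq_top.2 hη]
  · rintro _ ⟨⟨α, hα, rfl⟩, h0⟩
    refine ⟨⟨-α, hΦ.neg_mem α hα, map_neg η α⟩, ?_⟩
    simpa using h0
  intro α' hα' β' hβ' hneg
  have hα0 : α' ≠ 0 := hα'.2
  have hβ0 : β' ≠ 0 := hβ'.2
  have key : ∀ u v c : ℝ, 0 < u → 0 < v → c ≤ 0 → u • α' + v • β' ≠ c • α' := by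
    intro u v c hu hv hc h
    have huc : 0 < u - c := by linarith
    apply hneg
    refine ⟨-(v / (u - c)), by have := div_pos hv huc; linarith, ?_⟩
    have h1 : (u - c) • α' = -(v • β') := by
      rw [sub_smul, ← h]; abel
    have h2 : α' = (u - c)⁻¹ • ((u - c) • α') := by
      rw [smul_smul, inv_mul_cancel₀ huc.ne', one_smul]
    rw [h2, h1, smul_neg, smul_smul, neg_smul, div_eq_inv_mul]
  have key' : ∀ u v c : ℝ, 0 < u → 0 < v → c ≤ 0 → u • α' + v • β' ≠ c • β' := by
    intro u v c hu hv hc h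
    have hvc : 0 < v - c := by linarith
    refine key u (v - c) 0 hu hvc le_rfl ?_
    rw [sub_smul, zero_smul, ← h]; abel
  set S : Set E := {γ ∈ Φ | ∃ a b : ℝ, 1 ≤ a ∧ 1 ≤ b ∧ η γ = a • α' + b • β'} with hS
  set H : Subgroup G := ⨆ γ ∈ S, X γ with hH
  have hHle : H ≤ ⨆ γ ∈ {γ ∈ η '' Φ \ {0} |
      ∃ a b : ℝ, 1 ≤ a ∧ 1 ≤ b ∧ γ = a • α' + b • β'}, Y γ := by
    refine iSup₂_le fun γ hγ => ?_
    obtain ⟨hγ, a, b, ha, hb, e⟩ := hγ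
    have hne : η γ ≠ 0 := by
      rw [e]
      simpa using key a b 0 (by linarith) (by linarith) le_rfl
    refine le_iSup₂_of_le (η γ) ⟨⟨⟨γ, hγ, rfl⟩, hne⟩, a, b, ha, hb, e⟩ ?_
    rw [hY]
    exact le_iSup₂_of_le (f := fun i (_ : i ∈ {α ∈ Φ | η α = η γ}) => X i) γ ⟨hγ, rfl⟩ le_rfl
  have hNα : ∀ α ∈ {α ∈ Φ | η α = α'}, X α ≤ Subgroup.normalizer (H : Set G) := by
    rintro α ⟨hα, hαe⟩
    refine aux_le_normalizer S X (X α) ?_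
    rintro γ ⟨hγ, a, b, ha, hb, e⟩
    refine (hX α hα γ hγ ?_).trans ?_
    · rintro ⟨c, hc, h⟩
      refine key a b c⁻¹ (by linarith) (by linarith) (inv_nonpos.2 hc.le) ?_
      rw [← e, ← hαe, h, map_smul, smul_smul, inv_mul_cancel₀ hc.ne, one_smul]
    · refine iSup₂_le fun δ hδ => ?_
      obtain ⟨hδ, p, q, hp, hq, hd⟩ := hδ
      refine le_iSup₂_of_le (f := fun i (_ : i ∈ S) => X i) δ
        ⟨hδ, p + q * a, q * b, by nlinarith, by nlinarith, ?_⟩ le_rfl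
      rw [hd, map_add, map_smul, map_smul, hαe, e]
      module
  have hNβ : ∀ β ∈ {β ∈ Φ | η β = β'}, X β ≤ Subgroup.normalizer (H : Set G) := by
    rintro β ⟨hβ, hβe⟩
    refine aux_le_normalizer S X (X β) ?_
    rintro γ ⟨hγ, a, b, ha, hb, e⟩
    refine (hX β hβ γ hγ ?_).trans ?_
    · rintro ⟨c, hc, h⟩
      refine key' a b c⁻¹ (by linarith) (by linarith) (inv_nonpos.2 hc.le) ?_
      rw [← e, ← hβe, h, map_smul, smul_smul, inv_mul_cancel₀ hc.ne, one_smul]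
    · refine iSup₂_le fun δ hδ => ?_
      obtain ⟨hδ, p, q, hp, hq, hd⟩ := hδ
      refine le_iSup₂_of_le (f := fun i (_ : i ∈ S) => X i) δ
        ⟨hδ, q * a, p + q * b, by nlinarith, by nlinarith, ?_⟩ le_rfl
      rw [hd, map_add, map_smul, map_smul, hβe, e]
      module
  refine le_trans ?_ hHle
  rw [hY α', hY β']
  refine aux_comm_iSup_le _ _ _ _ hNα fun α hα => ?_
  rw [Subgroup.commutator_comm]
  refine aux_comm_iSup_le _ _ _ _ hNβ fun β hβ => ?_
  rw [Subgroup.commutator_comm]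
  obtain ⟨hα, hαe⟩ := hα
  obtain ⟨hβ, hβe⟩ := hβ
  refine (hX α hα β hβ ?_).trans ?_
  · rintro ⟨c, hc, h⟩
    exact hneg ⟨c, hc, by rw [← hαe, ← hβe, h, map_smul]⟩
  · refine iSup₂_le fun δ hδ => ?_
    obtain ⟨hδ, p, q, hp, hq, hd⟩ := hδ
    refine le_iSup₂_of_le (f := fun i (_ : i ∈ S) => X i) δ ⟨hδ, p, q, hp, hq, ?_⟩ le_rfl
    rw [hd, map_add, map_smul, map_smul, hαe, hβe]
end

section
/- Let Φ be a root system, let η be a k-good reduction of Φ (k ≥ 2 an integer) with induced root system Φ′ = η(Φ) \ {0}, and let {X_α}_{α∈Φ} be a k-strong Φ-grading of a group G. Then the coarsened family {Y_{α′}}_{α′∈Φ′}, where Y_{α′} = ⟨X_α : η(α) = α′⟩, is a strong Φ′-grading of G; in particular, the subgroups Y_{α′} generate G. -/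
section Helpers

theorem exists_dual_pair {E : Type*} [AddCommGroup E] [Module ℝ E] {α β : E}
    (h : LinearIndependent ℝ ![α, β]) (x y : ℝ) :
    ∃ l : E →ₗ[ℝ] ℝ, l α = x ∧ l β = y := by
  obtain ⟨l, hl⟩ := LinearMap.exists_extend
    ((Module.Basis.span h).constr ℝ (M' := ℝ) ![x, y])
  have h1 : ∀ i, l (![α, β] i) = ![x, y] i := by
    intro i
    have e : ((Module.Basis.span h i : _) : E) = ![α, β] i :=
      congrArg Subtype.val (Module.Basis.span_apply h i)
    have := LinearMap.congr_fun hl (Module.Basis.span h i)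
    rw [Module.Basis.constr_basis] at this
    rw [← this, LinearMap.comp_apply, Submodule.subtype_apply]
    exact congrArg l e.symm
  exact ⟨l, h1 0, h1 1⟩

theorem pair_indep {E : Type*} [AddCommGroup E] [Module ℝ E] {α β : E}
    (hα : α ≠ 0) (h : ¬ ∃ c : ℝ, β = c • α) : LinearIndependent ℝ ![α, β] := by
  rw [LinearIndependent.pair_iff' hα]
  intro a ha
  exact h ⟨a, ha.symm⟩

/-- small perturbation keeps positivity on a finite set and avoids zeros -/
theorem perturb {E : Type*} [AddCommGroup E] [Module ℝ E] (P S : Set E) (hP : P.Finite)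
    (hS : S.Finite) (h0 r : E →ₗ[ℝ] ℝ) (hpos : ∀ p ∈ P, 0 < h0 p) (hr : ∀ s ∈ S, r s ≠ 0) :
    ∃ ε : ℝ, 0 < ε ∧ (∀ p ∈ P, 0 < (h0 + ε • r) p) ∧ ∀ s ∈ S, (h0 + ε • r) s ≠ 0 := by
  have e1 : ∀ᶠ ε : ℝ in nhdsWithin 0 (Set.Ioi 0), ∀ p ∈ P, 0 < (h0 + ε • r) p := by
    rw [Filter.eventually_all_finite hP]
    intro p hp
    apply Filter.Eventually.filter_mono nhdsWithin_le_nhds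
    have hc : Continuous fun ε : ℝ => (h0 + ε • r) p := by
      simp only [LinearMap.add_apply, LinearMap.smul_apply, smul_eq_mul]; fun_prop
    have := hc.tendsto 0
    exact this.eventually (lt_mem_nhds (by simpa using hpos p hp))
  have e2 : ∀ᶠ ε : ℝ in nhdsWithin 0 (Set.Ioi 0), ∀ s ∈ S, (h0 + ε • r) s ≠ 0 := by
    rw [Filter.eventually_all_finite hS]
    intro s hs
    have hrs := hr s hs
    by_cases h : h0 s = 0
    · filter_upwards [self_mem_nhdsWithin] with ε hε
      have : ε ≠ 0 := ne_of_gt hε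
      simp [h, hrs, this]
    · apply Filter.Eventually.filter_mono nhdsWithin_le_nhds
      have hc : Continuous fun ε : ℝ => (h0 + ε • r) s := by
        simp only [LinearMap.add_apply, LinearMap.smul_apply, smul_eq_mul]; fun_prop
      exact (hc.tendsto 0).eventually_ne (by simpa using h)
  obtain ⟨ε, ⟨h1, h2⟩, h3⟩ := ((e1.and e2).and (self_mem_nhdsWithin)).exists
  exact ⟨ε, h3, h1, h2⟩

theorem exists_regular_s12 {E : Type*} [AddCommGroup E] [Module ℝ E] [FiniteDimensional ℝ E]
    (Ψ P : Set E) (hΨ : Ψ.Finite) (h0Ψ : (0 : E) ∉ Ψ) (hP : P.Finite)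
    (h0 : E →ₗ[ℝ] ℝ) (hpos : ∀ p ∈ P, 0 < h0 p) :
    ∃ h : E →ₗ[ℝ] ℝ, IsRegularFunc Ψ h ∧ ∀ p ∈ P, 0 < h p := by
  set S : Set E := (Ψ ∪ Set.image2 (· - ·) Ψ Ψ) \ {0} with hS
  have hSf : S.Finite := (hΨ.union (hΨ.image2 _ hΨ)).sdiff
  obtain ⟨r, hr⟩ : ∃ r : E →ₗ[ℝ] ℝ, ∀ s ∈ S, r s ≠ 0 := by
    have : Finite S := hSf
    obtain ⟨r, hr⟩ := Module.exists_dual_forall_apply_ne_zero (K := ℝ) (fun s : S => (s : E))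
      (fun s => s.2.2)
    exact ⟨r, fun s hs => hr ⟨s, hs⟩⟩
  obtain ⟨ε, -, h1, h2⟩ := perturb P S hP hSf h0 r hpos hr
  refine ⟨_, ⟨fun α hα => h2 α ⟨Or.inl hα, ?_⟩, fun α hα β hβ hne heq => ?_⟩, h1⟩
  · rintro rfl; exact h0Ψ hα
  · refine h2 (α - β) ⟨Or.inr ⟨α, hα, β, hβ, rfl⟩, ?_⟩ ?_
    · simpa [sub_eq_zero] using hne
    · rw [map_sub, heq, sub_self]

/-- Co-maximal Borel sets differ only along one line. -/
theorem not_comaximal {E : Type*} [AddCommGroup E] [Module ℝ E] [FiniteDimensional ℝ E]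
    (Ψ : Set E) (hΨ : Ψ.Finite) (h0Ψ : (0 : E) ∉ Ψ) (f g : E →ₗ[ℝ] ℝ)
    (α γ : E) (hα : α ∈ Ψ) (hγ : γ ∈ Ψ) (hli : LinearIndependent ℝ ![α, γ])
    (hfα : 0 < f α) (hfγ : 0 < f γ) (hgα : g α < 0) (hgγ : g γ < 0) :
    ¬ CoMaximal Ψ (borelSet Ψ f) (borelSet Ψ g) := by
  intro hco
  -- the convex combination (up to scale) vanishing on α
  set h0 : E →ₗ[ℝ] ℝ := (-(g α)) • f + (f α) • g with hh0
  have h0α : h0 α = 0 := by simp [hh0]; ring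
  have h0pos : ∀ p ∈ borelSet Ψ f ∩ borelSet Ψ g, 0 < h0 p := by
    rintro p ⟨⟨_, h1⟩, ⟨_, h2⟩⟩
    simp only [hh0, LinearMap.add_apply, LinearMap.smul_apply, smul_eq_mul]
    have := mul_pos (neg_pos.2 hgα) h1
    have := mul_pos hfα h2
    linarith
  have hPf : (borelSet Ψ f ∩ borelSet Ψ g).Finite := hΨ.subset (fun x hx => hx.1.1)
  have key : ∃ h : E →ₗ[ℝ] ℝ, (∀ p ∈ borelSet Ψ f ∩ borelSet Ψ g, 0 < h p) ∧
      ((0 < h α ∧ h γ < 0) ∨ (h α < 0 ∧ 0 < h γ)) := by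
    rcases le_total 0 (h0 γ) with hc | hc
    · obtain ⟨l, l1, l2⟩ := exists_dual_pair hli (-1) 1
      obtain ⟨ε, hε, h1, -⟩ := perturb _ ∅ hPf Set.finite_empty h0 l h0pos (by simp)
      refine ⟨_, h1, Or.inr ?_⟩
      simp only [LinearMap.add_apply, LinearMap.smul_apply, smul_eq_mul, h0α, l1, l2]
      constructor <;> linarith
    · obtain ⟨l, l1, l2⟩ := exists_dual_pair hli 1 (-1)
      obtain ⟨ε, hε, h1, -⟩ := perturb _ ∅ hPf Set.finite_empty h0 l h0pos (by simp)
      refine ⟨_, h1, Or.inl ?_⟩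
      simp only [LinearMap.add_apply, LinearMap.smul_apply, smul_eq_mul, h0α, l1, l2]
      constructor <;> linarith
  obtain ⟨h, hp, hs⟩ := key
  have fin : ∀ u v : E, u ∈ Ψ → v ∈ Ψ → 0 < f u → g v < 0 → 0 < f v → g u < 0 → 0 < h u → h v < 0 → False := by
    intro u v hu hv fu gv fv gu h1 h2
    obtain ⟨k, hk, hkp⟩ := exists_regular_s12 Ψ
      (insert u (insert (-v) (borelSet Ψ f ∩ borelSet Ψ g))) hΨ h0Ψ
      ((hPf.insert _).insert _) h (by
        rintro p (rfl | rfl | hp')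
        · exact h1
        · simpa using h2
        · exact hp p hp')
    have ku : 0 < k u := hkp u (by simp)
    have kv : k v < 0 := by simpa using hkp (-v) (by simp)
    rcases hco (borelSet Ψ k) ⟨k, hk, rfl⟩ (fun p hp' => ⟨hp'.1.1, hkp p (by simp [hp'])⟩)
      with e | e
    · have : v ∈ borelSet Ψ k := e ▸ ⟨hv, fv⟩
      exact absurd this.2 (not_lt.2 kv.le)
    · have : u ∈ borelSet Ψ g := e ▸ ⟨hu, ku⟩
      exact absurd this.2 (not_lt.2 gu.le)
  rcases hs with ⟨a, b⟩ | ⟨a, b⟩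
  · exact fin α γ hα hγ hfα hgγ hfγ hgα a b
  · exact fin γ α hγ hα hfγ hgα hfα hgγ b a

theorem mem_core {E : Type*} [AddCommGroup E] [Module ℝ E] [FiniteDimensional ℝ E]
    (Ψ : Set E) (hΨ : Ψ.Finite) (h0Ψ : (0 : E) ∉ Ψ)
    (α β γ : E) (hα : α ∈ Ψ) (hβ : β ∈ Ψ) (hγ : γ ∈ Ψ)
    (hab : LinearIndependent ℝ ![α, β]) (hac : LinearIndependent ℝ ![α, γ])
    (hbc : LinearIndependent ℝ ![β, γ]) (a b : ℝ) (ha : 0 < a) (hb : 0 < b)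
    (hγe : γ = a • α + b • β) :
    ∃ f : E →ₗ[ℝ] ℝ, IsRegularFunc Ψ f ∧ γ ∈ borelCore Ψ f := by
  obtain ⟨l, l1, l2⟩ := exists_dual_pair hab 1 1
  obtain ⟨f, hf, hfp⟩ := exists_regular_s12 Ψ {α, β} hΨ h0Ψ (by simp) l (by
    rintro p (rfl | rfl) <;> simp [l1, l2])
  have fα := hfp α (by simp)
  have fβ := hfp β (by simp)
  have fγ : 0 < f γ := by
    rw [hγe]; simp only [map_add, map_smul, smul_eq_mul]; positivity
  refine ⟨f, hf, ⟨hγ, fγ⟩, ?_⟩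
  simp only [borelBoundary, Set.mem_iUnion, not_exists]
  rintro B ⟨⟨g, hg, rfl⟩, hco⟩ ⟨-, hn⟩
  have gγ : g γ < 0 := lt_of_le_of_ne (not_lt.1 fun h => hn ⟨hγ, h⟩) (hg.1 γ hγ)
  have hd : g α < 0 ∨ g β < 0 := by
    by_contra! hh
    have : g γ = a * g α + b * g β := by rw [hγe]; simp
    have := mul_nonneg ha.le hh.1
    have := mul_nonneg hb.le hh.2
    linarith
  rcases hd with h | h
  · exact not_comaximal Ψ hΨ h0Ψ f g α γ hα hγ hac fα fγ h gγ hco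
  · exact not_comaximal Ψ hΨ h0Ψ f g β γ hβ hγ hbc fβ fγ h gγ hco

theorem regular_mem_core {E : Type*} [AddCommGroup E] [Module ℝ E] [FiniteDimensional ℝ E]
    (Ψ : Set E) (hΨ : Ψ.Finite) (h0Ψ : (0 : E) ∉ Ψ) (hneg : ∀ α ∈ Ψ, -α ∈ Ψ)
    (hreg : IsRegularRS Ψ) (γ : E) (hγ : γ ∈ Ψ) :
    ∃ f : E →ₗ[ℝ] ℝ, IsRegularFunc Ψ f ∧ γ ∈ borelCore Ψ f := by
  obtain ⟨Θ, hsub, hirr, hrk, hγΘ⟩ := hreg γ hγ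
  have hΘΨ : Θ ⊆ Ψ := fun x hx => by rw [hsub] at hx; exact hx.1
  have hne : ∀ x ∈ Θ, x ≠ 0 := fun x hx h => h0Ψ (h ▸ hΘΨ hx)
  have hγ0 := hne γ hγΘ
  have h1 : ∃ α ∈ Θ, ¬ ∃ c : ℝ, α = c • γ := by
    by_contra! hh
    have hle : Submodule.span ℝ Θ ≤ Submodule.span ℝ {γ} := by
      rw [Submodule.span_le]
      intro x hx
      obtain ⟨c, rfl⟩ := hh x hx
      exact Submodule.smul_mem _ _ (Submodule.mem_span_singleton_self γ)
    have := Submodule.finrank_mono hle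
    rw [finrank_span_singleton hγ0] at this
    unfold rankOf at hrk
    omega
  obtain ⟨α, hα, hαγ⟩ := h1
  have hα0 := hne α hα
  have hγα : LinearIndependent ℝ ![γ, α] := pair_indep hγ0 hαγ
  have hαγ' : LinearIndependent ℝ ![α, γ] := LinearIndependent.pair_symm_iff.1 hγα
  have h2 : ∃ β ∈ Θ, (¬ ∃ c : ℝ, β = c • γ) ∧ ¬ ∃ c : ℝ, β = c • α := by
    by_contra! hh
    apply hirr
    refine ⟨{x ∈ Θ | ∃ c : ℝ, x = c • γ}, {x ∈ Θ | ¬ ∃ c : ℝ, x = c • γ},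
      ⟨γ, hγΘ, 1, by simp⟩, ⟨α, hα, hαγ⟩, ?_, ?_, ?_⟩
    · ext x; simp only [Set.mem_union, Set.mem_setOf_eq]; tauto
    · rw [Set.disjoint_left]; rintro x ⟨_, hx⟩ ⟨_, hx'⟩; exact hx' hx
    · rw [eq_bot_iff]
      rintro x ⟨hx1, hx2⟩
      have hx1' : x ∈ Submodule.span ℝ {γ} := by
        refine (Submodule.span_le.2 ?_) hx1
        rintro y ⟨_, c, rfl⟩
        exact Submodule.smul_mem _ _ (Submodule.mem_span_singleton_self γ)
      have hx2' : x ∈ Submodule.span ℝ {α} := by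
        refine (Submodule.span_le.2 ?_) hx2
        rintro y ⟨hy, hyc⟩
        obtain ⟨c, rfl⟩ := hh y hy (by simpa using hyc)
        exact Submodule.smul_mem _ _ (Submodule.mem_span_singleton_self α)
      obtain ⟨c, rfl⟩ := Submodule.mem_span_singleton.1 hx1'
      obtain ⟨d, hd⟩ := Submodule.mem_span_singleton.1 hx2'
      have := (LinearIndependent.pair_iff.1 hγα) c (-d) (by rw [neg_smul, hd]; simp)
      simp [this.1]
  obtain ⟨β, hβ, hβγ, hβα⟩ := h2
  have hβ0 := hne β hβ
  have hγβ : LinearIndependent ℝ ![γ, β] := pair_indep hγ0 hβγ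
  have hβγ' : LinearIndependent ℝ ![β, γ] := LinearIndependent.pair_symm_iff.1 hγβ
  have hαβ : LinearIndependent ℝ ![α, β] := pair_indep hα0 hβα
  have hspan : Submodule.span ℝ {α, β} = Submodule.span ℝ Θ := by
    apply Submodule.eq_of_le_of_finrank_eq
    · apply Submodule.span_mono
      rintro x (rfl | rfl) <;> assumption
    · have := finrank_span_eq_card hαβ
      have hr : Set.range ![α, β] = {α, β} := Matrix.range_cons_cons_empty α β _
      rw [hr, Fintype.card_fin] at this
      unfold rankOf at hrk
      exact this.trans hrk.symm
  have hm : γ ∈ Submodule.span ℝ {α, β} := hspan ▸ Submodule.subset_span hγΘ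
  obtain ⟨a, b, hab⟩ := Submodule.mem_span_pair.1 hm
  have ha : a ≠ 0 := by
    rintro rfl
    have := (LinearIndependent.pair_iff.1 hγβ) 1 (-b) (by rw [← hab]; simp)
    simp at this
  have hb : b ≠ 0 := by
    rintro rfl
    have := (LinearIndependent.pair_iff.1 hγα) 1 (-a) (by rw [← hab]; simp)
    simp at this
  have sgn : ∀ (a : ℝ) (u : E), a ≠ 0 → u ∈ Ψ → ∃ s : ℝ, s ≠ 0 ∧ s * s = 1 ∧ 0 < a * s ∧ s • u ∈ Ψ := by
    intro a u ha hu
    rcases lt_or_gt_of_ne ha with h | h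
    · exact ⟨-1, by norm_num, by norm_num, by linarith, by simpa using hneg u hu⟩
    · exact ⟨1, by norm_num, by norm_num, by linarith, by simpa using hu⟩
  obtain ⟨s, s0, s1, s2, s3⟩ := sgn a α ha (hΘΨ hα)
  obtain ⟨t, t0, t1, t2, t3⟩ := sgn b β hb (hΘΨ hβ)
  have scale : ∀ (s t : ℝ) (u v : E), s ≠ 0 → t ≠ 0 → LinearIndependent ℝ ![u, v] →
      LinearIndependent ℝ ![s • u, t • v] := by
    intro s t u v hs ht h
    rw [LinearIndependent.pair_iff] at h ⊢
    intro x y hxy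
    have := h (x * s) (y * t) (by simpa [mul_smul] using hxy)
    simpa [hs, ht] using this
  refine mem_core Ψ hΨ h0Ψ (s • α) (t • β) γ s3 t3 hγ (scale s t _ _ s0 t0 hαβ)
    (by simpa using scale s 1 _ _ s0 one_ne_zero hαγ')
    (by simpa using scale t 1 _ _ t0 one_ne_zero hβγ') (a * s) (b * t) s2 t2 ?_
  rw [smul_smul, smul_smul, mul_assoc, s1, mul_assoc, t1, mul_one, mul_one, hab]

open scoped commutatorElement in
/-- Commutators of generated subgroups land in a subgroup normalized by the generators. -/
theorem iSup_commutator_le {G ι κ : Type*} [Group G] (A : ι → Subgroup G) (B : κ → Subgroup G)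
    (I : Set ι) (J : Set κ) (H : Subgroup G)
    (hc : ∀ i ∈ I, ∀ j ∈ J, ⁅A i, B j⁆ ≤ H)
    (hA : ∀ i ∈ I, A i ≤ Subgroup.normalizer (H : Set G))
    (hB : ∀ j ∈ J, B j ≤ Subgroup.normalizer (H : Set G)) :
    ⁅⨆ i ∈ I, A i, ⨆ j ∈ J, B j⁆ ≤ H := by
  -- the elements of the normalizer that commute with `T` modulo `H`
  have step : ∀ (T : Subgroup G) (_ : T ≤ Subgroup.normalizer (H : Set G)),
      ∃ K : Subgroup G, ∀ x, x ∈ K ↔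
        (x ∈ Subgroup.normalizer (H : Set G) ∧ ∀ t ∈ T, ⁅x, t⁆ ∈ H) := by
    intro T hT
    refine ⟨{ carrier := {x | x ∈ Subgroup.normalizer (H : Set G) ∧ ∀ t ∈ T, ⁅x, t⁆ ∈ H}
              one_mem' := ⟨one_mem _, fun t _ => by simp⟩
              mul_mem' := ?_
              inv_mem' := ?_ }, fun x => Iff.rfl⟩
    · rintro x y ⟨hx, hx'⟩ ⟨hy, hy'⟩
      refine ⟨mul_mem hx hy, fun t ht => ?_⟩
      have e : ⁅x * y, t⁆ = (x * ⁅y, t⁆ * x⁻¹) * ⁅x, t⁆ := by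
        simp only [commutatorElement_def]; group
      rw [e]
      exact mul_mem ((Subgroup.mem_normalizer_iff.1 hx _).1 (hy' t ht)) (hx' t ht)
    · rintro x ⟨hx, hx'⟩
      refine ⟨inv_mem hx, fun t ht => ?_⟩
      have e : ⁅x⁻¹, t⁆ = x⁻¹ * ⁅x, t⁆⁻¹ * x⁻¹⁻¹ := by
        simp only [commutatorElement_def]; group
      rw [e]
      exact (Subgroup.mem_normalizer_iff.1 (inv_mem hx) _).1 (inv_mem (hx' t ht))
  -- first enlarge the left-hand argument
  have s1 : ∀ j ∈ J, ⁅⨆ i ∈ I, A i, B j⁆ ≤ H := by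
    intro j hj
    obtain ⟨K, hK⟩ := step (B j) (hB j hj)
    have : (⨆ i ∈ I, A i) ≤ K := iSup₂_le fun i hi x hx =>
      (hK x).2 ⟨hA i hi hx, fun t ht => hc i hi j hj (Subgroup.commutator_mem_commutator hx ht)⟩
    rw [Subgroup.commutator_le]
    exact fun x hx t ht => ((hK x).1 (this hx)).2 t ht
  obtain ⟨K, hK⟩ := step (⨆ i ∈ I, A i) (iSup₂_le hA)
  have : (⨆ j ∈ J, B j) ≤ K := iSup₂_le fun j hj x hx =>
    (hK x).2 ⟨hB j hj hx, fun t ht => by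
      have := s1 j hj (Subgroup.commutator_mem_commutator ht hx)
      rw [← commutatorElement_inv]
      exact inv_mem this⟩
  rw [Subgroup.commutator_comm, Subgroup.commutator_le]
  exact fun x hx t ht => ((hK x).1 (this hx)).2 t ht

open scoped commutatorElement in
/-- A subgroup `T` whose commutators with the generators of `H` lie in `H` normalizes `H`. -/
theorem le_normalizer_iSup {G ι : Type*} [Group G] (T : Subgroup G) (A : ι → Subgroup G)
    (I : Set ι) (h : ∀ i ∈ I, ⁅T, A i⁆ ≤ ⨆ i ∈ I, A i) :
    T ≤ Subgroup.normalizer ((⨆ i ∈ I, A i : Subgroup G) : Set G) := by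
  have key : ∀ t ∈ T, ∀ x ∈ ⨆ i ∈ I, A i, t * x * t⁻¹ ∈ ⨆ i ∈ I, A i := by
    intro t ht x hx
    have : (⨆ i ∈ I, A i) ≤ (⨆ i ∈ I, A i).comap (MulAut.conj t).toMonoidHom := by
      refine iSup₂_le fun i hi y hy => ?_
      have h1 := h i hi (Subgroup.commutator_mem_commutator ht hy)
      have h2 : y ∈ ⨆ i ∈ I, A i := (le_iSup₂_of_le (f := fun i (_ : i ∈ I) => A i) i hi le_rfl) hy
      have h3 := mul_mem h1 h2
      have e : ⁅t, y⁆ * y = t * y * t⁻¹ := by simp [commutatorElement_def]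
      rw [e] at h3
      simpa using h3
    simpa using this hx
  intro t ht
  rw [Subgroup.mem_normalizer_iff]
  intro x
  refine ⟨key t ht x, fun hx => ?_⟩
  have := key t⁻¹ (inv_mem ht) _ hx
  simpa [mul_assoc] using this

end Helpers

/-- Lemma 6.4: a `k`-good reduction of a `k`-strongly graded group yields a strong
grading by the induced root system.  Here `η : E → V'` is a surjective linear map,
`Φ' = η(Φ) \ {0}` the induced root system, and the two hypotheses `hgood_a` and
`hgood_b` express that the reduction `η` is `k`-good:
(a) every root in `ker η` lies in an irreducible regular rank-`k` subsystem `Ψ`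
with `ker η ∩ Ψ ⊆ ℝγ`; (b) for every `f' ∈ F(Φ')`, `γ' ∈ C_{f'}` and `γ ∈ Φ` with
`η γ = γ'`, there are an irreducible rank-`k` subsystem `Ψ` and `g ∈ F(Ψ)` with
`γ ∈ C_g`, `η(Ψ_g) ⊆ Φ'_{f'}` and `Ψ ∩ η⁻¹(ℝγ') ⊆ ℝγ`.  If `{X_α}` is a
`k`-strong `Φ`-grading of `G`, then the coarsened family
`Y_{α'} = ⟨X_α : η α = α'⟩` is a strong `Φ'`-grading of `G` (in particular the
`Y_{α'}` generate `G`). -/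
theorem statement12 {E V' : Type*} [AddCommGroup E] [Module ℝ E] [FiniteDimensional ℝ E]
    [AddCommGroup V'] [Module ℝ V'] [Nontrivial V'] [FiniteDimensional ℝ V']
    (Φ : Set E) (hΦ : IsRootSystem Φ) (k : ℕ) (hk : 2 ≤ k)
    (η : E →ₗ[ℝ] V') (hη : Function.Surjective η)
    (Φ' : Set V') (hΦ' : Φ' = η '' Φ \ {0})
    (hgood_a : ∀ γ ∈ Φ, η γ = 0 →
      ∃ Ψ : Set E, IsSubsystem Φ Ψ ∧ IsIrreducibleRS Ψ ∧ IsRegularRS Ψ ∧ rankOf Ψ = k ∧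
        γ ∈ Ψ ∧ ∀ β ∈ Ψ, η β = 0 → ∃ c : ℝ, β = c • γ)
    (hgood_b : ∀ f' : V' →ₗ[ℝ] ℝ, IsRegularFunc Φ' f' →
      ∀ γ' ∈ borelCore Φ' f', ∀ γ ∈ Φ, η γ = γ' →
      ∃ (Ψ : Set E) (g : E →ₗ[ℝ] ℝ), IsSubsystem Φ Ψ ∧ IsIrreducibleRS Ψ ∧ rankOf Ψ = k ∧
        IsRegularFunc Ψ g ∧ γ ∈ borelCore Ψ g ∧ η '' borelSet Ψ g ⊆ borelSet Φ' f' ∧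
        ∀ β ∈ Ψ, (∃ c : ℝ, η β = c • γ') → ∃ c : ℝ, β = c • γ)
    {G : Type*} [Group G] (X : E → Subgroup G)
    (hgrad : IsGrading Φ X) (hkstrong : IsKStrong Φ X k)
    (Y : V' → Subgroup G) (hY : ∀ α' : V', Y α' = ⨆ α ∈ {α ∈ Φ | η α = α'}, X α) :
    IsGrading Φ' Y ∧ IsStrong Φ' Y := by
  obtain ⟨hgc, hgen⟩ := hgrad
  have subΦ : ∀ {Ψ : Set E}, IsSubsystem Φ Ψ → Ψ ⊆ Φ := fun hs x hx => by
    rw [hs] at hx; exact hx.1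
  have memΦ' : ∀ α ∈ Φ, η α ≠ 0 → η α ∈ Φ' := fun α hα h => by
    rw [hΦ']; exact ⟨⟨α, hα, rfl⟩, h⟩
  have XleY : ∀ α ∈ Φ, X α ≤ Y (η α) := fun α hα => by
    rw [hY]; exact le_iSup₂_of_le (f := fun a (_ : a ∈ {a ∈ Φ | η a = η α}) => X a) α ⟨hα, rfl⟩ le_rfl
  refine ⟨⟨?_, ?_⟩, ?_⟩
  · -- grading condition
    intro α' hα' β' hβ' hnn
    have nz : ∀ a b : ℝ, 0 < a → 0 < b → a • α' + b • β' ≠ 0 := by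
      intro a b ha hb h
      refine hnn ⟨-(b / a), neg_neg_of_pos (div_pos hb ha), ?_⟩
      have h1 : a • α' = -(b • β') := eq_neg_of_add_eq_zero_left h
      have h2 : α' = a⁻¹ • (a • α') := by rw [smul_smul, inv_mul_cancel₀ ha.ne', one_smul]
      rw [h2, h1, smul_neg, smul_smul, neg_smul, div_eq_inv_mul]
    set I : Set E := {γ ∈ Φ | ∃ a b : ℝ, 1 ≤ a ∧ 1 ≤ b ∧ η γ = a • α' + b • β'} with hI
    have hle : (⨆ γ ∈ I, X γ) ≤
        ⨆ γ ∈ {γ ∈ Φ' | ∃ a b : ℝ, 1 ≤ a ∧ 1 ≤ b ∧ γ = a • α' + b • β'}, Y γ := by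
      refine iSup₂_le fun γ hγ => (XleY γ hγ.1).trans ?_
      obtain ⟨hγΦ, a, b, ha, hb, hab⟩ := hγ
      refine le_iSup₂_of_le
        (f := fun a (_ : a ∈ {γ ∈ Φ' | ∃ a b : ℝ, 1 ≤ a ∧ 1 ≤ b ∧ γ = a • α' + b • β'}) => Y a)
        (η γ) ⟨memΦ' γ hγΦ ?_, a, b, ha, hb, hab⟩ le_rfl
      rw [hab]; exact nz a b (by linarith) (by linarith)
    refine le_trans ?_ hle
    -- general commutator estimate for roots over nonnegative combinations
    have gen : ∀ u ∈ Φ, ∀ v ∈ Φ, ∀ p q r s : ℝ, 0 ≤ p → 0 ≤ q → 0 ≤ r → 0 ≤ s →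
        1 ≤ p + r → 1 ≤ q + s → η u = p • α' + q • β' → η v = r • α' + s • β' →
        ⁅X u, X v⁆ ≤ ⨆ γ ∈ I, X γ := by
      intro u hu v hv p q r s hp hq hr hs hpr hqs eu ev
      have comb : ∀ a b : ℝ, η (a • u + b • v) = (a * p + b * r) • α' + (a * q + b * s) • β' := by
        intro a b
        rw [map_add, map_smul, map_smul, eu, ev]
        module
      refine (hgc u hu v hv ?_).trans ?_
      · rintro ⟨c, hc, e⟩
        have h0 : η ((1 : ℝ) • u + (-c) • v) = 0 := by rw [e]; simp
        rw [comb] at h0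
        have pos : ∀ x y : ℝ, 0 ≤ x → 0 ≤ y → 1 ≤ x + y → 0 < 1 * x + (-c) * y := by
          intro x y hx hy hxy
          rcases hx.eq_or_lt with h | h
          · have : 0 < y := by linarith
            have := mul_pos (neg_pos.2 hc) this
            linarith
          · have := mul_nonneg (neg_pos.2 hc).le hy
            linarith
        exact nz _ _ (pos p r hp hr hpr) (pos q s hq hs hqs) h0
      · refine iSup₂_le fun γ hγ => ?_
        obtain ⟨hγΦ, a, b, ha, hb, rfl⟩ := hγ
        refine le_iSup₂_of_le (f := fun a (_ : a ∈ I) => X a) _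
          ⟨hγΦ, _, _, ?_, ?_, comb a b⟩ le_rfl <;> nlinarith
    rw [hY, hY]
    apply iSup_commutator_le
    · rintro u ⟨hu, eu⟩ v ⟨hv, ev⟩
      exact gen u hu v hv 1 0 0 1 (by simp) (by simp) (by simp) (by simp) (by simp) (by simp)
        (by simpa using eu) (by simpa using ev)
    · rintro u ⟨hu, eu⟩
      apply le_normalizer_iSup
      rintro v ⟨hv, a, b, ha, hb, ev⟩
      exact gen u hu v hv 1 0 a b (by simp) (by simp) (by linarith) (by linarith) (by linarith)
        (by linarith) (by simpa using eu) ev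
    · rintro u ⟨hu, eu⟩
      apply le_normalizer_iSup
      rintro v ⟨hv, a, b, ha, hb, ev⟩
      exact gen u hu v hv 0 1 a b (by simp) (by simp) (by linarith) (by linarith) (by linarith)
        (by linarith) (by simpa using eu) ev
  · -- generation
    have nzle : ∀ α ∈ Φ, η α ≠ 0 → X α ≤ ⨆ α' ∈ Φ', Y α' := fun α hα h =>
      (XleY α hα).trans (le_iSup₂_of_le (f := fun a (_ : a ∈ Φ') => Y a) _ (memΦ' α hα h) le_rfl)
    rw [eq_top_iff, ← hgen]
    refine iSup₂_le fun γ hγ => ?_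
    by_cases h0 : η γ = 0
    · obtain ⟨Ψ, hsub, hirr, hreg, hrk, hγΨ, hker⟩ := hgood_a γ hγ h0
      have hΨΦ := subΦ hsub
      obtain ⟨f, hf, hcore⟩ := regular_mem_core Ψ (hΦ.finite.subset hΨΦ)
        (fun h => hΦ.zero_notMem (hΨΦ h))
        (fun α hα => by
          rw [hsub]
          exact ⟨hΦ.neg_mem α (hΨΦ hα), Submodule.neg_mem _ (Submodule.subset_span hα)⟩)
        hreg γ hγΨ
      refine ((hkstrong Ψ hsub hirr hrk).2 f hf γ hcore).trans (iSup₂_le ?_)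
      rintro β ⟨⟨hβ, _⟩, hn⟩
      exact nzle β (hΨΦ hβ) fun h => hn (hker β hβ h)
    · exact nzle γ hγ h0
  · -- strength
    intro f' hf' γ' hγ'
    rw [hY]
    refine iSup₂_le ?_
    rintro γ ⟨hγ, e⟩
    obtain ⟨Ψ, g, hsub, hirr, hrk, hg, hcore, him, hline⟩ := hgood_b f' hf' γ' hγ' γ hγ e
    refine ((hkstrong Ψ hsub hirr hrk).2 g hg γ hcore).trans (iSup₂_le ?_)
    rintro β ⟨hβ, hn⟩
    refine (XleY β (subΦ hsub hβ.1)).trans ?_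
    exact le_iSup₂_of_le
      (f := fun a (_ : a ∈ {β ∈ borelSet Φ' f' | ¬ ∃ c : ℝ, β = c • γ'}) => Y a) (η β)
      ⟨him ⟨β, hβ, rfl⟩, fun h => hn (hline β hβ.1 h)⟩ le_rfl
end
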